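/- arXiv:1803.00856 — 3 statements merged into one kernel-verified Lean document; each statement's English description precedes it below -/
import Mathlib

section
/- Let K be of class C¹ on H². Assume that at least one of the following conditions holds: (i) ∂₁K(z) ≠ 0 for every z ∈ H²; (ii) ∇K(z)·z ≠ 0 for every z ∈ H²; (iii) ∇K(z)·(z₁²−z₂², 2z₁z₂) ≠ 0 for every z ∈ H². Then no embedded K-loop exists. -/
open Real MeasureTheory Filter Topology

noncomputable section

/-- Rotation by π/2 in the plane: `iw = (-w₂, w₁)`. -/
def rot (w : ℝ × ℝ) : ℝ × ℝ := (-w.2, w.1)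

/-- The Christoffel-type term `Γ(w) = (2w₁w₂, w₂² - w₁²)`. -/
def Gam (w : ℝ × ℝ) : ℝ × ℝ := (2 * w.1 * w.2, w.2 ^ 2 - w.1 ^ 2)

/-- Euclidean dot product in ℝ². -/
def dotp (v w : ℝ × ℝ) : ℝ := v.1 * w.1 + v.2 * w.2

/-- The hyperbolic length-type functional `L(u) = ((1/2π)∫₀^{2π} u₂⁻²|u'|² dt)^{1/2}`. -/
def hypL (u : ℝ → ℝ × ℝ) : ℝ :=
  Real.sqrt ((1 / (2 * π)) * ∫ t in (0:ℝ)..(2 * π),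
    ((deriv u t).1 ^ 2 + (deriv u t).2 ^ 2) / (u t).2 ^ 2)

/-- `u` is a `K`-loop in the upper half-plane model of the hyperbolic plane:
a nonconstant C² `2π`-periodic curve with values in `H²` solving
`u'' - u₂⁻¹ Γ(u') = L(u) K(u) iu'`. -/
def IsKLoop (K : (ℝ × ℝ) → ℝ) (u : ℝ → ℝ × ℝ) : Prop :=
  ContDiff ℝ 2 u ∧ Function.Periodic u (2 * π) ∧ (∀ t, 0 < (u t).2) ∧
  (¬ ∃ c, ∀ t, u t = c) ∧
  ∀ t, deriv (deriv u) t - ((u t).2)⁻¹ • Gam (deriv u t)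
      = (hypL u * K (u t)) • rot (deriv u t)

/-- A `2π`-periodic curve is embedded if it is injective modulo `2π`. -/
def IsEmbedded (u : ℝ → ℝ × ℝ) : Prop :=
  ∀ t s : ℝ, u t = u s → ∃ n : ℤ, t - s = 2 * π * (n : ℝ)

/-- Twice the Wirtinger derivative `∂F/∂z̄`. -/
def twoDbar (F : ℂ → ℂ) (z : ℂ) : ℂ :=
  fderiv ℝ F z 1 + Complex.I * fderiv ℝ F z Complex.I

theorem continuous_twoDbar {F : ℂ → ℂ} (hF : ContDiff ℝ 1 F) : Continuous (twoDbar F) := by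
  have := hF.continuous_fderiv one_ne_zero
  unfold twoDbar
  fun_prop

theorem hasCompactSupport_twoDbar {F : ℂ → ℂ} (hc : HasCompactSupport F) :
    HasCompactSupport (twoDbar F) := by
  refine (hc.fderiv (𝕜 := ℝ)).mono fun z hz h0 => hz ?_
  simp only [twoDbar]
  rw [h0]; simp

theorem twoDbar_eq_polar (F : ℂ → ℂ) (z : ℂ) (θ : ℝ) :
    twoDbar F z * Complex.exp (-(θ * Complex.I)) =
      fderiv ℝ F z (Complex.exp (θ * Complex.I)) +
        Complex.I * fderiv ℝ F z (Complex.I * Complex.exp (θ * Complex.I)) := by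
  have e1 : Complex.exp (θ * Complex.I) = (Real.cos θ) • (1 : ℂ) + (Real.sin θ) • Complex.I := by
    rw [Complex.exp_mul_I]; simp
  have e2 : Complex.I * Complex.exp (θ * Complex.I)
      = (-Real.sin θ) • (1 : ℂ) + (Real.cos θ) • Complex.I := by
    rw [Complex.exp_mul_I]; simp; ring_nf; simp; ring
  have e3 : Complex.exp (-(θ * Complex.I)) = (Real.cos θ : ℂ) - Real.sin θ * Complex.I := by
    rw [← neg_mul, Complex.exp_mul_I]; simp; ring
  rw [e2, e1, e3, map_add, map_add, map_smul, map_smul, map_smul, map_smul, twoDbar]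
  simp only [Complex.real_smul]
  push_cast
  linear_combination (-Complex.sin θ * fderiv ℝ F z Complex.I) * Complex.I_sq

theorem integrableOn_polar_target {h : ℝ × ℝ → ℂ} (hh : Continuous h) {R : ℝ}
    (hR : ∀ p : ℝ × ℝ, R < p.1 → h p = 0) :
    IntegrableOn h (Set.Ioi (0 : ℝ) ×ˢ Set.Ioo (-π) π) := by
  have h1 : IntegrableOn h (Set.Icc 0 R ×ˢ Set.Icc (-π) π) :=
    hh.continuousOn.integrableOn_compact (isCompact_Icc.prod isCompact_Icc)
  refine h1.of_forall_sdiff_eq_zero (measurableSet_Ioi.prod measurableSet_Ioo) ?_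
  rintro ⟨r, θ⟩ ⟨⟨h2, h3⟩, h4⟩
  apply hR
  by_contra h5
  exact h4 ⟨⟨le_of_lt h2, not_lt.mp h5⟩, ⟨h3.1.le, h3.2.le⟩⟩

/-- Cauchy–Pompeiu formula for compactly supported `C¹` functions on the plane. -/
theorem integral_twoDbar_div {F : ℂ → ℂ} (hF : ContDiff ℝ 1 F) (hc : HasCompactSupport F) (p : ℂ) :
    ∫ ζ : ℂ, twoDbar F (p + ζ) / ζ = -(2 * π) * F p := by
  have hfd : Continuous (fderiv ℝ F) := hF.continuous_fderiv one_ne_zero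
  have hdiff : ∀ z, HasFDerivAt F (fderiv ℝ F z) z :=
    fun z => (hF.differentiable one_ne_zero z).hasFDerivAt
  obtain ⟨R, hR⟩ : ∃ R : ℝ, ∀ z : ℂ, R < ‖z‖ → F (p + z) = 0 ∧ fderiv ℝ F (p + z) = 0 := by
    obtain ⟨R, hR⟩ := (hc.isCompact).isBounded.exists_norm_le
    refine ⟨R + ‖p‖, fun z hz => ?_⟩
    have hnot : p + z ∉ tsupport F := fun hmem => by
      have h1 := hR _ hmem
      have h2 : ‖z‖ ≤ ‖p + z‖ + ‖p‖ := by
        simpa using norm_sub_le (p + z) p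
      linarith
    exact ⟨image_eq_zero_of_notMem_tsupport hnot,
      by_contra fun h3 => hnot (support_fderiv_subset ℝ h3)⟩
  let e : ℝ → ℂ := fun θ => Complex.exp (θ * Complex.I)
  have he : Continuous e := by fun_prop
  have hen : ∀ θ, ‖e θ‖ = 1 := fun θ => Complex.norm_exp_ofReal_mul_I θ
  let A : ℝ × ℝ → ℂ := fun q => fderiv ℝ F (p + q.1 * e q.2) (e q.2)
  let B : ℝ × ℝ → ℂ := fun q => Complex.I * fderiv ℝ F (p + q.1 * e q.2) (Complex.I * e q.2)
  have hA : Continuous A := by unfold A; fun_prop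
  have hB : Continuous B := by unfold B; fun_prop
  have hbig : ∀ q : ℝ × ℝ, max R 0 < q.1 → R < ‖(q.1 : ℂ) * e q.2‖ := fun q hq => by
    rw [norm_mul, hen, mul_one, Complex.norm_real, Real.norm_eq_abs]
    exact ((le_max_left _ _).trans_lt hq).trans_le (le_abs_self _)
  have hA0 : ∀ q : ℝ × ℝ, max R 0 < q.1 → A q = 0 := fun q hq => by
    simp [A, (hR _ (hbig q hq)).2]
  have hB0 : ∀ q : ℝ × ℝ, max R 0 < q.1 → B q = 0 := fun q hq => by
    simp [B, (hR _ (hbig q hq)).2]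
  have hAi := integrableOn_polar_target hA hA0
  have hBi := integrableOn_polar_target hB hB0
  rw [← Complex.integral_comp_polarCoord_symm]
  have htarget : polarCoord.target = Set.Ioi (0 : ℝ) ×ˢ Set.Ioo (-π) π := rfl
  rw [htarget]
  have hpt : ∀ q ∈ Set.Ioi (0 : ℝ) ×ˢ Set.Ioo (-π) π,
      q.1 • (twoDbar F (p + Complex.polarCoord.symm q) / Complex.polarCoord.symm q)
        = A q + B q := by
    rintro ⟨r, θ⟩ ⟨hr, -⟩
    have hr0 : (r : ℂ) ≠ 0 := by exact_mod_cast (ne_of_gt hr)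
    have hs : Complex.polarCoord.symm (r, θ) = r * e θ := by
      simp only [e, Complex.polarCoord_symm_apply, Complex.exp_mul_I]
      push_cast; ring
    have := twoDbar_eq_polar F (p + r * e θ) θ
    simp only [A, B]
    rw [hs, ← this, Complex.exp_neg, Complex.real_smul]
    have : e θ ≠ 0 := Complex.exp_ne_zero _
    simp only [e] at this ⊢
    field_simp
  rw [setIntegral_congr_fun (measurableSet_Ioi.prod measurableSet_Ioo) hpt, integral_add hAi hBi]
  have hde : ∀ θ, HasDerivAt e (Complex.I * e θ) θ := fun θ => by
    have h1 : HasDerivAt (fun θ : ℝ => (θ : ℂ) * Complex.I) (1 * Complex.I) θ :=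
      (Complex.ofRealCLM.hasDerivAt).mul_const _
    have := h1.cexp
    simpa [e, mul_comm] using this
  have hIntA : ∫ q in Set.Ioi (0 : ℝ) ×ˢ Set.Ioo (-π) π, A q = -(2 * π) * F p := by
    rw [Measure.volume_eq_prod, ← setIntegral_prod_swap, 
      setIntegral_prod (fun z : ℝ × ℝ => A z.swap) hAi.swap]
    have hin : ∀ θ : ℝ, ∫ r in Set.Ioi (0 : ℝ), A (r, θ) = - F p := by
      intro θ
      have hd : ∀ r ∈ Set.Ici (0 : ℝ),
          HasDerivAt (fun r : ℝ => F (p + r * e θ)) (A (r, θ)) r := by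
        intro r _
        have h1 : HasDerivAt (fun r : ℝ => p + (r : ℂ) * e θ) (1 * e θ) r :=
          ((Complex.ofRealCLM.hasDerivAt).mul_const _).const_add _
        rw [one_mul] at h1
        exact (hdiff _).comp_hasDerivAt r h1
      have hint : IntegrableOn (fun r => A (r, θ)) (Set.Ioi 0) := by
        have h1 : IntegrableOn (fun r => A (r, θ)) (Set.Icc 0 (max R 0)) :=
          (hA.comp (by fun_prop : Continuous fun r : ℝ => (r, θ))).continuousOn.integrableOn_compact
            isCompact_Icc
        refine h1.of_forall_sdiff_eq_zero measurableSet_Ioi ?_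
        rintro r ⟨h2, h4⟩
        apply hA0
        by_contra h5
        exact h4 ⟨le_of_lt h2, not_lt.mp h5⟩
      have hlim : Tendsto (fun r : ℝ => F (p + r * e θ)) atTop (𝓝 0) := by
        refine tendsto_const_nhds.congr' ?_
        filter_upwards [eventually_gt_atTop (max R 0)] with r hr
        exact ((hR _ (hbig (r, θ) hr)).1).symm
      rw [integral_Ioi_of_hasDerivAt_of_tendsto' hd hint hlim]
      simp
    simp only [Prod.swap_prod_mk, hin]
    simp [Real.pi_pos.le]
    left
    ring
  have hIntB : ∫ q in Set.Ioi (0 : ℝ) ×ˢ Set.Ioo (-π) π, B q = 0 := by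
    rw [Measure.volume_eq_prod, setIntegral_prod _ hBi]
    refine setIntegral_eq_zero_of_forall_eq_zero fun r hr => ?_
    have hr0 : (r : ℂ) ≠ 0 := by exact_mod_cast (ne_of_gt hr)
    have hd : ∀ θ ∈ Set.uIcc (-π) π,
        HasDerivAt (fun θ : ℝ => Complex.I * F (p + r * e θ) / r) (B (r, θ)) θ := by
      intro θ _
      have h1 : HasDerivAt (fun θ : ℝ => p + (r : ℂ) * e θ) (r * (Complex.I * e θ)) θ :=
        ((hde θ).const_mul _).const_add _
      have h2 := (((hdiff _).comp_hasDerivAt θ h1).const_mul Complex.I).div_const (r : ℂ)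
      have h3 : Complex.I * fderiv ℝ F (p + r * e θ) (r * (Complex.I * e θ)) / r = B (r, θ) := by
        rw [← Complex.real_smul (x := r) (z := Complex.I * e θ), map_smul, Complex.real_smul]
        simp only [B]
        field_simp
      exact h3 ▸ h2
    rw [← integral_Ioc_eq_integral_Ioo, ← intervalIntegral.integral_of_le (by linarith [Real.pi_pos]),
      intervalIntegral.integral_eq_sub_of_hasDerivAt hd
        (Continuous.intervalIntegrable (by fun_prop) _ _)]
    have : e π = e (-π) := by
      simp [e, Complex.exp_neg, Complex.exp_pi_mul_I]
    rw [this, sub_self]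
  rw [hIntA, hIntB, add_zero]

theorem integrable_indicator_ball_norm_inv (R : ℝ) :
    Integrable (fun ζ : ℂ => (Metric.closedBall (0 : ℂ) R).indicator (fun ζ => ‖ζ‖⁻¹) ζ) := by
  refine ⟨(Measurable.indicator (by fun_prop)
    Metric.isClosed_closedBall.measurableSet).aestronglyMeasurable, ?_⟩
  rw [HasFiniteIntegral, ← Complex.lintegral_comp_polarCoord_symm]
  have hs : MeasurableSet (Set.Icc 0 R ×ˢ Set.Icc (-π) π) :=
    measurableSet_Icc.prod measurableSet_Icc
  calc ∫⁻ q in polarCoord.target, ENNReal.ofReal q.1 •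
        ‖(Metric.closedBall (0 : ℂ) R).indicator (fun ζ => ‖ζ‖⁻¹) (Complex.polarCoord.symm q)‖ₑ
      ≤ ∫⁻ q in polarCoord.target, (Set.Icc 0 R ×ˢ Set.Icc (-π) π).indicator 1 q := by
        refine setLIntegral_mono (measurable_one.indicator hs) ?_
        rintro ⟨r, θ⟩ ⟨hr : 0 < r, hθ⟩
        by_cases hrR : r ≤ R
        · have hq : (r, θ) ∈ Set.Icc 0 R ×ˢ Set.Icc (-π) π := ⟨⟨hr.le, hrR⟩, ⟨hθ.1.le, hθ.2.le⟩⟩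
          rw [Set.indicator_of_mem hq]
          refine (mul_le_mul_right (enorm_indicator_le_enorm_self _ _) _).trans ?_
          rw [Complex.norm_polarCoord_symm, abs_of_pos hr, enorm_inv hr.ne',
            Real.enorm_eq_ofReal hr.le]
          exact ENNReal.mul_inv_le_one _
        · rw [Set.indicator_of_notMem]
          · simp
          · simp only [Metric.mem_closedBall, dist_zero_right, Complex.norm_polarCoord_symm]
            rw [abs_of_pos hr]
            exact hrR
    _ ≤ ∫⁻ q, (Set.Icc 0 R ×ˢ Set.Icc (-π) π).indicator 1 q := setLIntegral_le_lintegral _ _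
    _ < ⊤ := by
        rw [lintegral_indicator_one hs]
        exact (isCompact_Icc.prod isCompact_Icc).measure_lt_top

/-- The Cauchy integral `∮ dv / (v - z)` over one period of a curve. -/
def cauchyInt (v : ℝ → ℂ) (z : ℂ) : ℂ := ∫ t in (0 : ℝ)..(2 * π), deriv v t / (v t - z)

theorem curveIntegral_eq_integral_twoDbar {v : ℝ → ℂ} (hv : ContDiff ℝ 1 v) {F : ℂ → ℂ}
    (hF : ContDiff ℝ 1 F) (hc : HasCompactSupport F) :
    (2 * π) * ∫ t in (0 : ℝ)..(2 * π), F (v t) * deriv v t =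
      ∫ z, twoDbar F z * cauchyInt v z := by
  have hvc : Continuous v := hv.continuous
  have hv'c : Continuous (deriv v) := hv.continuous_deriv le_rfl
  have hG := continuous_twoDbar hF
  have hGc := hasCompactSupport_twoDbar hc
  obtain ⟨M, hM⟩ := hG.bounded_above_of_compact_support hGc
  obtain ⟨R, hR⟩ := hGc.isCompact.isBounded.exists_norm_le
  obtain ⟨V, hV⟩ := (isCompact_Icc (a := (0 : ℝ)) (b := 2 * π)).exists_bound_of_continuousOn
    hvc.continuousOn
  obtain ⟨V', hV'⟩ := (isCompact_Icc (a := (0 : ℝ)) (b := 2 * π)).exists_bound_of_continuousOn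
    hv'c.continuousOn
  have h2pi : (0 : ℝ) ≤ 2 * π := by positivity
  have hV'0 : 0 ≤ V' := (norm_nonneg _).trans (hV' 0 ⟨le_rfl, h2pi⟩)
  have hM0 : 0 ≤ M := (norm_nonneg _).trans (hM 0)
  let b : ℂ → ℝ := fun ζ => M * V' *
    (Metric.closedBall (0 : ℂ) (R + V)).indicator (fun ζ => ‖ζ‖⁻¹) ζ
  have hb : Integrable b := (integrable_indicator_ball_norm_inv (R + V)).const_mul _
  let f : ℝ → ℂ → ℂ := fun t z => twoDbar F z * (deriv v t / (v t - z))
  have hfm : Measurable (Function.uncurry f) := by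
    have : Function.uncurry f = fun q : ℝ × ℂ => twoDbar F q.2 * (deriv v q.1 / (v q.1 - q.2)) := rfl
    rw [this]
    have h1 : Measurable fun q : ℝ × ℂ => twoDbar F q.2 := hG.measurable.comp measurable_snd
    have h2 : Measurable fun q : ℝ × ℂ => deriv v q.1 := hv'c.measurable.comp measurable_fst
    have h3 : Measurable fun q : ℝ × ℂ => v q.1 := hvc.measurable.comp measurable_fst
    exact h1.mul (h2.div (h3.sub measurable_snd))
  have hbound : ∀ t ∈ Set.Icc (0 : ℝ) (2 * π), ∀ z, ‖f t z‖ ≤ b (z - v t) := by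
    intro t ht z
    by_cases hz : z ∈ tsupport (twoDbar F)
    · have hmem : z - v t ∈ Metric.closedBall (0 : ℂ) (R + V) := by
        rw [mem_closedBall_zero_iff]
        exact (norm_sub_le _ _).trans (add_le_add (hR z hz) (hV t ht))
      simp only [f, b]
      rw [Set.indicator_of_mem hmem, norm_mul, norm_div, div_eq_mul_inv, norm_sub_rev (v t) z,
        ← mul_assoc]
      gcongr
      · exact hM z
      · exact hV' t ht
    · have : f t z = 0 := by simp [f, image_eq_zero_of_notMem_tsupport hz]
      rw [this, norm_zero]
      exact mul_nonneg (mul_nonneg hM0 hV'0)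
        (Set.indicator_nonneg (fun _ _ => inv_nonneg.mpr (norm_nonneg _)) _)
  have hslice : ∀ t ∈ Set.Icc (0 : ℝ) (2 * π), Integrable (f t) := fun t ht =>
    (hb.comp_sub_right (v t)).mono' (hfm.comp measurable_prodMk_left).aestronglyMeasurable
      (Eventually.of_forall (hbound t ht))
  have hint : Integrable (Function.uncurry f) ((volume.restrict (Set.uIoc 0 (2 * π))).prod volume) := by
    rw [Set.uIoc_of_le h2pi]
    rw [integrable_prod_iff hfm.aestronglyMeasurable]
    constructor
    · filter_upwards [ae_restrict_mem measurableSet_Ioc] with t ht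
      exact hslice t ⟨ht.1.le, ht.2⟩
    · refine Integrable.mono' (g := fun _ => ∫ ζ, b ζ) (integrable_const _)
        hfm.stronglyMeasurable.norm.integral_prod_right.aestronglyMeasurable ?_
      filter_upwards [ae_restrict_mem measurableSet_Ioc] with t ht
      have ht' : t ∈ Set.Icc (0 : ℝ) (2 * π) := ⟨ht.1.le, ht.2⟩
      rw [Real.norm_of_nonneg (integral_nonneg fun _ => norm_nonneg _),
        ← integral_sub_right_eq_self b (v t)]
      exact integral_mono (hslice t ht').norm (hb.comp_sub_right (v t)) (hbound t ht')
  have hrhs : ∀ z, twoDbar F z * cauchyInt v z = ∫ t in (0 : ℝ)..(2 * π), f t z := fun z => by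
    simp only [cauchyInt, f, intervalIntegral.integral_const_mul]
  have hlhs : ∀ t, ∫ z, f t z = 2 * π * (F (v t) * deriv v t) := by
    intro t
    have h1 := integral_twoDbar_div hF hc (v t)
    rw [← integral_add_left_eq_self (f t) (v t)]
    have h2 : ∀ ζ, f t (v t + ζ) = -deriv v t * (twoDbar F (v t + ζ) / ζ) := by
      intro ζ
      simp only [f, sub_add_cancel_left, div_eq_mul_inv]
      rw [inv_neg]
      ring
    simp_rw [h2, integral_const_mul, h1]
    ring
  simp_rw [hrhs]
  rw [← intervalIntegral_integral_swap hint]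
  simp_rw [hlhs]
  rw [intervalIntegral.integral_const_mul]

theorem hasDerivAt_integral_deriv_div {v : ℝ → ℂ} (hv : ContDiff ℝ 1 v) {a b : ℝ} {z : ℂ}
    (hz : z ∉ v '' Set.uIcc a b) :
    HasDerivAt (fun w => ∫ t in a..b, deriv v t / (v t - w))
      (∫ t in a..b, deriv v t / (v t - z) ^ 2) z := by
  have hvc : Continuous v := hv.continuous
  have hv'c : Continuous (deriv v) := hv.continuous_deriv le_rfl
  have hclosed : IsClosed (v '' Set.uIcc a b) := (isCompact_uIcc.image hvc).isClosed
  obtain ⟨r, hr, hball⟩ := Metric.isOpen_iff.mp hclosed.isOpen_compl z hz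
  have hfar : ∀ t ∈ Set.uIcc a b, ∀ w ∈ Metric.ball z (r / 2), r / 2 ≤ ‖v t - w‖ := by
    intro t ht w hw
    by_contra hlt
    refine hball (a := v t) ?_ ⟨t, ht, rfl⟩
    rw [Metric.mem_ball, dist_eq_norm] at hw ⊢
    have := norm_add_le (v t - w) (w - z)
    rw [sub_add_sub_cancel] at this
    linarith
  have hne : ∀ t ∈ Set.uIcc a b, ∀ w ∈ Metric.ball z (r / 2), v t - w ≠ 0 := fun t ht w hw h0 => by
    have := hfar t ht w hw
    rw [h0, norm_zero] at this
    linarith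
  have hz2 : z ∈ Metric.ball z (r / 2) := Metric.mem_ball_self (half_pos hr)
  refine (intervalIntegral.hasDerivAt_integral_of_dominated_loc_of_deriv_le
    (F := fun w t => deriv v t / (v t - w)) (F' := fun w t => deriv v t / (v t - w) ^ 2)
    (bound := fun t => ‖deriv v t‖ / (r / 2) ^ 2)
    (Metric.ball_mem_nhds z (half_pos hr)) ?_ ?_ ?_ ?_ ?_ ?_).2
  · refine Eventually.of_forall fun w => ?_
    exact (hv'c.measurable.div (hvc.measurable.sub_const _)).aestronglyMeasurable
  · refine ContinuousOn.intervalIntegrable ?_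
    exact hv'c.continuousOn.div (by fun_prop) fun t ht => hne t ht z hz2
  · exact (hv'c.measurable.div ((hvc.measurable.sub_const _).pow_const _)).aestronglyMeasurable
  · refine Eventually.of_forall fun t ht w hw => ?_
    rw [norm_div, norm_pow]
    have := hfar t (Set.uIoc_subset_uIcc ht) w hw
    gcongr
  · exact Continuous.intervalIntegrable (by fun_prop) _ _
  · refine Eventually.of_forall fun t ht w hw => ?_
    have h0 := hne t (Set.uIoc_subset_uIcc ht) w hw
    have h1 : HasDerivAt (fun w => v t - w) (-1) w := by
      simpa using (hasDerivAt_id w).const_sub (v t)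
    have h2 := (hasDerivAt_const w (deriv v t)).div h1 h0
    have h3 : (0 * (v t - w) - deriv v t * -1) / (v t - w) ^ 2 = deriv v t / (v t - w) ^ 2 := by
      ring
    exact h3 ▸ h2

theorem isCompact_range_of_periodic {v : ℝ → ℂ} (hv : Continuous v)
    (hp : Function.Periodic v (2 * π)) : IsCompact (Set.range v) := by
  rw [← hp.image_Icc Real.two_pi_pos 0]
  exact isCompact_Icc.image hv

theorem hasDerivAt_cauchyInt {v : ℝ → ℂ} (hv : ContDiff ℝ 1 v) (hp : Function.Periodic v (2 * π))
    {z : ℂ} (hz : z ∉ Set.range v) : HasDerivAt (cauchyInt v) 0 z := by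
  have hvc : Continuous v := hv.continuous
  have hv'c : Continuous (deriv v) := hv.continuous_deriv le_rfl
  have h := hasDerivAt_integral_deriv_div hv (a := 0) (b := 2 * π) (z := z)
    fun hmem => hz (Set.image_subset_range _ _ hmem)
  have hne : ∀ t, v t - z ≠ 0 := fun t h0 => hz ⟨t, sub_eq_zero.mp h0⟩
  have h0 : ∫ t in (0 : ℝ)..(2 * π), deriv v t / (v t - z) ^ 2 = 0 := by
    have hd : ∀ t ∈ Set.uIcc 0 (2 * π),
        HasDerivAt (fun t => -(v t - z)⁻¹) (deriv v t / (v t - z) ^ 2) t := by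
      intro t _
      have h1 : HasDerivAt (fun t => v t - z) (deriv v t) t :=
        ((hv.differentiable one_ne_zero t).hasDerivAt).sub_const z
      have h2 := (h1.inv (hne t)).neg
      rw [neg_div, neg_neg] at h2
      exact h2
    rw [intervalIntegral.integral_eq_sub_of_hasDerivAt hd]
    · have : v (2 * π) = v 0 := by simpa using hp 0
      rw [this, sub_self]
    · refine Continuous.intervalIntegrable ?_ _ _
      exact hv'c.div (by fun_prop) fun t => pow_ne_zero 2 (hne t)
  rw [h0] at h
  exact h

theorem eventually_cauchyInt_eq {v : ℝ → ℂ} (hv : ContDiff ℝ 1 v)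
    (hp : Function.Periodic v (2 * π)) {z : ℂ} (hz : z ∉ Set.range v) :
    ∀ᶠ w in 𝓝 z, w ∉ Set.range v ∧ cauchyInt v w = cauchyInt v z := by
  have hclosed := (isCompact_range_of_periodic hv.continuous hp).isClosed
  obtain ⟨r, hr, hball⟩ := Metric.isOpen_iff.mp hclosed.isOpen_compl z hz
  filter_upwards [Metric.ball_mem_nhds z hr] with w hw
  refine ⟨hball hw, ?_⟩
  exact Metric.isOpen_ball.is_const_of_deriv_eq_zero (convex_ball z r).isPreconnected
    (fun x hx => (hasDerivAt_cauchyInt hv hp (hball hx)).differentiableAt.differentiableWithinAt)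
    (fun x hx => (hasDerivAt_cauchyInt hv hp (hball hx)).deriv) hw (Metric.mem_ball_self hr)

theorem cauchyInt_eq_of_isPreconnected {v : ℝ → ℂ} (hv : ContDiff ℝ 1 v)
    (hp : Function.Periodic v (2 * π)) {S : Set ℂ} (hS : IsPreconnected S)
    (hSv : ∀ z ∈ S, z ∉ Set.range v) {z w : ℂ} (hz : z ∈ S) (hw : w ∈ S) :
    cauchyInt v z = cauchyInt v w := by
  refine hS.induction₂ (fun z w => cauchyInt v z = cauchyInt v w) ?_
    (fun _ _ _ _ _ _ => Eq.trans) (fun _ _ _ _ => Eq.symm) hz hw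
  intro x hx
  exact nhdsWithin_le_nhds
    ((eventually_cauchyInt_eq hv hp (hSv x hx)).mono fun y hy => hy.2.symm)

theorem cauchyInt_eq_zero_of_notMem_convex {v : ℝ → ℂ} (hv : ContDiff ℝ 1 v)
    (hp : Function.Periodic v (2 * π)) {C : Set ℂ} (hC : Convex ℝ C) (hvC : Set.range v ⊆ C)
    {z : ℂ} (hz : z ∉ C) : cauchyInt v z = 0 := by
  have hvc : Continuous v := hv.continuous
  have hv'c : Continuous (deriv v) := hv.continuous_deriv le_rfl
  let γ : ℝ → ℂ := fun s => z + s • (z - v 0)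
  have hγ : Continuous γ := by fun_prop
  have hv0 : v 0 ∈ C := hvC ⟨0, rfl⟩
  have hoff : ∀ s ∈ Set.Ici (0 : ℝ), γ s ∉ C := by
    intro s (hs : 0 ≤ s) hmem
    apply hz
    have h1 : (0 : ℝ) < 1 + s := by linarith
    have := hC hmem hv0 (a := 1 / (1 + s)) (b := s / (1 + s)) (by positivity) (by positivity)
      (by field_simp)
    convert this using 1
    simp only [γ, Complex.real_smul]
    have h2 : (1 + s : ℂ) ≠ 0 := by exact_mod_cast h1.ne'
    push_cast
    field_simp
    ring
  have hconst : ∀ s ∈ Set.Ici (0 : ℝ), cauchyInt v (γ s) = cauchyInt v z := by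
    intro s hs
    refine cauchyInt_eq_of_isPreconnected hv hp (S := γ '' Set.Ici 0)
      (isPreconnected_Ici.image _ hγ.continuousOn) ?_ ⟨s, hs, rfl⟩ ⟨0, Set.self_mem_Ici, by simp [γ]⟩
    rintro _ ⟨s, hs, rfl⟩ hr
    exact hoff s hs (hvC hr)
  obtain ⟨V, hV⟩ := (isCompact_Icc (a := (0 : ℝ)) (b := 2 * π)).exists_bound_of_continuousOn
    hvc.continuousOn
  obtain ⟨V', hV'⟩ := (isCompact_Icc (a := (0 : ℝ)) (b := 2 * π)).exists_bound_of_continuousOn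
    hv'c.continuousOn
  have hzv : 0 < ‖z - v 0‖ := norm_pos_iff.mpr fun h0 => hz (by rwa [sub_eq_zero.mp h0])
  have hlim : Tendsto (fun s : ℝ => V' / (s * ‖z - v 0‖ - ‖z‖ - V) * |2 * π - 0|) atTop (𝓝 0) := by
    have h1 : Tendsto (fun s : ℝ => s * ‖z - v 0‖ - ‖z‖ - V) atTop atTop := by
      have := (tendsto_id (α := ℝ)).atTop_mul_const hzv
      simpa [sub_eq_add_neg] using
        (tendsto_atTop_add_const_right _ (-V) (tendsto_atTop_add_const_right _ (-‖z‖) this))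
    simpa using (h1.const_div_atTop V').mul_const |2 * π - 0|
  refine norm_le_zero_iff.mp (ge_of_tendsto hlim ?_)
  filter_upwards [eventually_ge_atTop 0,
    eventually_gt_atTop ((‖z‖ + V) / ‖z - v 0‖)] with s hs hs2
  rw [← hconst s hs]
  rw [div_lt_iff₀ hzv] at hs2
  refine intervalIntegral.norm_integral_le_of_norm_le_const fun t ht => ?_
  rw [Set.uIoc_of_le Real.two_pi_pos.le] at ht
  have ht' : t ∈ Set.Icc (0 : ℝ) (2 * π) := ⟨ht.1.le, ht.2⟩
  rw [norm_div]
  have h3 : s * ‖z - v 0‖ - ‖z‖ - V ≤ ‖v t - γ s‖ := by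
    have e1 : s • (z - v 0) = v t - z - (v t - γ s) := by simp only [γ]; ring
    have e2 : ‖s • (z - v 0)‖ = s * ‖z - v 0‖ := by rw [norm_smul, Real.norm_of_nonneg hs]
    have e3 := norm_sub_le (v t - z) (v t - γ s)
    have e4 := norm_sub_le (v t) z
    rw [← e1, e2] at e3
    linarith [hV t ht']
  have h4 : 0 < s * ‖z - v 0‖ - ‖z‖ - V := by linarith
  exact div_le_div₀ ((norm_nonneg _).trans (hV' t ht')) (hV' t ht') h4 h3

theorem volume_range_eq_zero {v : ℝ → ℂ} (hv : ContDiff ℝ 1 v) :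
    volume (Set.range v) = 0 := by
  have h1 : volume ((LinearMap.ker Complex.imLm : Submodule ℝ ℂ) : Set ℂ) = 0 := by
    refine Measure.addHaar_submodule _ _ fun h => ?_
    have : Complex.I ∈ LinearMap.ker Complex.imLm := h ▸ Submodule.mem_top
    simp at this
  have h2 := addHaar_image_eq_zero_of_differentiableOn_of_addHaar_eq_zero volume
    (f := fun z : ℂ => v z.re) (s := ((LinearMap.ker Complex.imLm : Submodule ℝ ℂ) : Set ℂ))
    (fun z _ => ((hv.differentiable one_ne_zero _).comp z
      Complex.reCLM.differentiableAt).differentiableWithinAt) h1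
  refine measure_mono_null ?_ h2
  rintro _ ⟨t, rfl⟩
  exact ⟨t, by simp, by simp⟩

/-- Small nonzero displacements of a simple closed regular curve along its normals, near a given
parameter, stay off the curve. -/
theorem exists_normal_notMem_range {v : ℝ → ℂ} (hv : ContDiff ℝ 1 v)
    (hp : Function.Periodic v (2 * π))
    (hinj : ∀ t s : ℝ, v t = v s → ∃ n : ℤ, t - s = 2 * π * (n : ℝ))
    (hreg : ∀ t, deriv v t ≠ 0) (t₀ : ℝ) :
    ∃ η > 0, ∀ t ∈ Metric.ball t₀ η, ∀ δ : ℝ, δ ≠ 0 → |δ| < η →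
      v t + δ * (Complex.I * deriv v t) ∉ Set.range v := by
  have hvc : Continuous v := hv.continuous
  have hv'c : Continuous (deriv v) := hv.continuous_deriv le_rfl
  set τ := deriv v t₀ with hτ
  have hτ0 : 0 < ‖τ‖ := norm_pos_iff.mpr (hreg t₀)
  have hstrict : HasStrictDerivAt v τ t₀ := hv.contDiffAt.hasStrictDerivAt one_ne_zero
  have h1 : ∀ᶠ q : ℝ × ℝ in 𝓝 (t₀, t₀),
      ‖v q.1 - v q.2 - (q.1 - q.2) • τ‖ ≤ ‖τ‖ / 4 * ‖q.1 - q.2‖ := by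
    have := (hasStrictFDerivAt_iff_isLittleO.mp hstrict.hasStrictFDerivAt).def
      (show 0 < ‖τ‖ / 4 by positivity)
    simpa using this
  obtain ⟨η₁, hη₁, h1⟩ := Metric.eventually_nhds_iff.mp h1
  have h2 : ∀ᶠ t in 𝓝 t₀, ‖deriv v t - τ‖ < ‖τ‖ / 4 := by
    have := Metric.tendsto_nhds.mp (hv'c.tendsto t₀) (‖τ‖ / 4) (by positivity)
    simpa [dist_eq_norm] using this
  obtain ⟨η₂, hη₂, h2⟩ := Metric.eventually_nhds_iff.mp h2
  let A : Set ℂ := v '' (Set.Icc (t₀ - π) (t₀ + π) \ Metric.ball t₀ η₁)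
  have hA : IsClosed A := ((isCompact_Icc.diff Metric.isOpen_ball).image hvc).isClosed
  have hA0 : v t₀ ∉ A := by
    rintro ⟨s, ⟨hs, hs'⟩, hst⟩
    obtain ⟨n, hn⟩ := hinj s t₀ hst
    have hpi := Real.pi_pos
    have hn1 : (n : ℝ) < 1 := by
      by_contra hcon
      nlinarith [hs.2, hs.1, not_lt.mp hcon]
    have hn2 : (-1 : ℝ) < n := by
      by_contra hcon
      nlinarith [hs.2, hs.1, not_lt.mp hcon]
    have hn0 : n = 0 := by
      have h3 : n < 1 := by exact_mod_cast hn1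
      have h4 : -1 < n := by exact_mod_cast hn2
      omega
    apply hs'
    rw [hn0] at hn
    have : s = t₀ := by simpa [sub_eq_zero] using hn
    rw [this]
    exact Metric.mem_ball_self hη₁
  have h3 : ∀ᶠ q : ℝ × ℝ in 𝓝 (t₀, 0), v q.1 + q.2 * (Complex.I * deriv v q.1) ∉ A := by
    have hc : Continuous fun q : ℝ × ℝ => v q.1 + q.2 * (Complex.I * deriv v q.1) := by fun_prop
    refine hc.continuousAt.eventually (hA.isOpen_compl.mem_nhds ?_)
    simpa using hA0
  obtain ⟨η₃, hη₃, h3⟩ := Metric.eventually_nhds_iff.mp h3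
  refine ⟨min η₁ (min η₂ η₃), by positivity, fun t ht δ hδ0 hδ => ?_⟩
  rw [lt_min_iff, lt_min_iff] at hδ
  rw [Metric.mem_ball, lt_min_iff, lt_min_iff] at ht
  rintro ⟨s', hs'⟩
  obtain ⟨s, hs, hss⟩ := hp.exists_mem_Ico Real.two_pi_pos s' (t₀ - π)
  rw [hss] at hs'
  have hsA : v s ∉ A := by
    rw [hs']
    refine h3 (y := (t, δ)) ?_
    rw [Prod.dist_eq, max_lt_iff]
    refine ⟨ht.2.2, ?_⟩
    simpa using hδ.2.2
  have hsη : dist s t₀ < η₁ := by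
    by_contra hcon
    exact hsA ⟨s, ⟨⟨hs.1, by linarith [hs.2]⟩, hcon⟩, rfl⟩
  have e1 := h1 (y := (s, t)) (by rw [Prod.dist_eq, max_lt_iff]; exact ⟨hsη, ht.1⟩)
  have e2 := h2 ht.2.1
  simp only at e1
  rw [hs'] at e1
  have e3 : ((δ : ℂ) * Complex.I - (s - t : ℝ)) * τ =
      (v t + δ * (Complex.I * deriv v t) - v t - (s - t) • τ) -
        δ * Complex.I * (deriv v t - τ) := by
    rw [Complex.real_smul]; ring
  have e4 : ‖(δ : ℂ) * Complex.I - (s - t : ℝ)‖ * ‖τ‖ ≤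
      ‖τ‖ / 4 * |s - t| + |δ| * (‖τ‖ / 4) := by
    rw [← norm_mul, e3]
    refine (norm_sub_le _ _).trans (add_le_add e1 ?_)
    rw [norm_mul, norm_mul, Complex.norm_I, mul_one, Complex.norm_real, Real.norm_eq_abs]
    gcongr
  have e5 : |s - t| ≤ ‖(δ : ℂ) * Complex.I - (s - t : ℝ)‖ := by
    have := Complex.abs_re_le_norm ((δ : ℂ) * Complex.I - (s - t : ℝ))
    simpa [abs_sub_comm] using this
  have e6 : |δ| ≤ ‖(δ : ℂ) * Complex.I - (s - t : ℝ)‖ := by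
    have := Complex.abs_im_le_norm ((δ : ℂ) * Complex.I - (s - t : ℝ))
    simpa using this
  have e7 : 0 < |δ| := abs_pos.mpr hδ0
  have e8 : ‖(δ : ℂ) * Complex.I - (s - t : ℝ)‖ ≤ (|s - t| + |δ|) / 4 := by
    refine le_of_mul_le_mul_right ?_ hτ0
    linarith
  linarith [abs_nonneg (s - t)]

/-- On each side of a simple closed regular curve, the Cauchy integral takes a single value
near the curve. -/
theorem exists_cauchyInt_side_eq {v : ℝ → ℂ} (hv : ContDiff ℝ 1 v)
    (hp : Function.Periodic v (2 * π))
    (hinj : ∀ t s : ℝ, v t = v s → ∃ n : ℤ, t - s = 2 * π * (n : ℝ))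
    (hreg : ∀ t, deriv v t ≠ 0) {σ : ℝ} (hσ : |σ| = 1) :
    ∃ c : ℂ, ∀ t, ∀ᶠ δ : ℝ in 𝓝[>] 0,
      v t + (σ * δ : ℝ) * (Complex.I * deriv v t) ∉ Set.range v ∧
        cauchyInt v (v t + (σ * δ : ℝ) * (Complex.I * deriv v t)) = c := by
  have hvc : Continuous v := hv.continuous
  have hv'c : Continuous (deriv v) := hv.continuous_deriv le_rfl
  have hσ0 : σ ≠ 0 := by
    rintro rfl
    simp at hσ
  have hloc : ∀ t₀, ∃ c : ℂ, ∀ᶠ t in 𝓝 t₀, ∀ᶠ δ : ℝ in 𝓝[>] 0,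
      v t + (σ * δ : ℝ) * (Complex.I * deriv v t) ∉ Set.range v ∧
        cauchyInt v (v t + (σ * δ : ℝ) * (Complex.I * deriv v t)) = c := by
    intro t₀
    obtain ⟨η, hη, h⟩ := exists_normal_notMem_range hv hp hinj hreg t₀
    let Φ : ℝ × ℝ → ℂ := fun q => v q.1 + (σ * q.2 : ℝ) * (Complex.I * deriv v q.1)
    have hΦ : Continuous Φ := by fun_prop
    have hoff : ∀ q ∈ Metric.ball t₀ η ×ˢ Set.Ioo 0 η, Φ q ∉ Set.range v := by
      rintro ⟨t, δ⟩ ⟨ht, hδ⟩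
      refine h t ht (σ * δ) (mul_ne_zero hσ0 hδ.1.ne') ?_
      rw [abs_mul, hσ, one_mul, abs_of_pos hδ.1]
      exact hδ.2
    have hconn : IsPreconnected (Φ '' (Metric.ball t₀ η ×ˢ Set.Ioo 0 η)) :=
      (((convex_ball t₀ η).isPreconnected).prod isPreconnected_Ioo).image _ hΦ.continuousOn
    have hmid : (t₀, η / 2) ∈ Metric.ball t₀ η ×ˢ Set.Ioo 0 η :=
      ⟨Metric.mem_ball_self hη, by constructor <;> linarith⟩
    refine ⟨cauchyInt v (Φ (t₀, η / 2)), ?_⟩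
    filter_upwards [Metric.ball_mem_nhds t₀ hη] with t ht
    filter_upwards [Ioo_mem_nhdsGT hη] with δ hδ
    refine ⟨hoff (t, δ) ⟨ht, hδ⟩, ?_⟩
    refine cauchyInt_eq_of_isPreconnected hv hp hconn ?_ ⟨(t, δ), ⟨ht, hδ⟩, rfl⟩ ⟨_, hmid, rfl⟩
    rintro _ ⟨q, hq, rfl⟩
    exact hoff q hq
  choose c hc using hloc
  have hlc : IsLocallyConstant c := by
    rw [IsLocallyConstant.iff_eventually_eq]
    intro t₀
    filter_upwards [hc t₀] with t ht
    obtain ⟨δ, h1, h2⟩ := (ht.and (hc t).self_of_nhds).exists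
    exact h2.2.symm.trans h1.2
  refine ⟨c 0, fun t => ?_⟩
  rw [← hlc.apply_eq_of_isPreconnected isPreconnected_univ (Set.mem_univ t) (Set.mem_univ 0)]
  exact (hc t).self_of_nhds

theorem log_sub_log_neg_of_im_pos {z : ℂ} (hz : 0 < z.im) :
    Complex.log z - Complex.log (-z) = π * Complex.I := by
  simp only [Complex.log, norm_neg, Complex.arg_neg_eq_arg_sub_pi_of_im_pos hz]
  push_cast
  ring

theorem log_sub_log_neg_of_im_neg {z : ℂ} (hz : z.im < 0) :
    Complex.log z - Complex.log (-z) = -(π * Complex.I) := by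
  simp only [Complex.log, norm_neg, Complex.arg_neg_eq_arg_add_pi_of_im_neg hz]
  push_cast
  ring

/-- The jump of the Cauchy integral across a simple closed regular curve is `2πi`. -/
theorem cauchyInt_jump {v : ℝ → ℂ} (hv : ContDiff ℝ 1 v)
    (hinj : ∀ t s : ℝ, v t = v s → ∃ n : ℤ, t - s = 2 * π * (n : ℝ))
    (hreg : ∀ t, deriv v t ≠ 0) {c : ℝ → ℂ}
    (hc : ∀ σ : ℝ, |σ| = 1 → ∀ᶠ δ : ℝ in 𝓝[>] 0,
      v π + (σ * δ : ℝ) * (Complex.I * deriv v π) ∉ Set.range v ∧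
        cauchyInt v (v π + (σ * δ : ℝ) * (Complex.I * deriv v π)) = c σ) :
    c 1 - c (-1) = 2 * π * Complex.I := by
  have hvc : Continuous v := hv.continuous
  have hv'c : Continuous (deriv v) := hv.continuous_deriv le_rfl
  set τ := deriv v π with hτ
  have hτne : τ ≠ 0 := hreg π
  have hτ0 : 0 < ‖τ‖ := norm_pos_iff.mpr hτne
  let q : ℝ → ℂ := fun t => (v t - v π) / τ
  have hqc : Continuous q := by fun_prop
  have hd : HasDerivAt v τ π := (hv.differentiable one_ne_zero π).hasDerivAt
  have hq1 : ∀ᶠ t in 𝓝 π, ‖q t - (t - π : ℝ)‖ ≤ 1 / 2 * |t - π| := by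
    have := (hasFDerivAt_iff_isLittleO.mp hd.hasFDerivAt).def
      (show 0 < ‖τ‖ / 2 by positivity)
    filter_upwards [this] with t ht
    have e1 : q t - (t - π : ℝ) = (v t - v π - (t - π) • τ) / τ := by
      simp only [q, Complex.real_smul]
      field_simp
    rw [e1, norm_div, div_le_iff₀ hτ0]
    simp only [ContinuousLinearMap.toSpanSingleton_apply, Real.norm_eq_abs] at ht
    linarith
  obtain ⟨η₀, hη₀, hq1⟩ := Metric.eventually_nhds_iff.mp hq1
  have hpi := Real.pi_pos
  obtain ⟨η, hη, hηη, hηpi⟩ : ∃ η > 0, η < η₀ ∧ η < π := by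
    refine ⟨min η₀ π / 2, by positivity, ?_, ?_⟩
    · linarith [min_le_left η₀ π, show 0 < min η₀ π by positivity]
    · linarith [min_le_right η₀ π, show 0 < min η₀ π by positivity]
  have hqre : ∀ t, |t - π| ≤ η → |(q t).re - (t - π)| ≤ 1 / 2 * |t - π| := by
    intro t ht
    have h1 := hq1 (y := t) (by rw [Real.dist_eq]; linarith)
    have h2 := Complex.abs_re_le_norm (q t - (t - π : ℝ))
    rw [Complex.sub_re, Complex.ofReal_re] at h2
    linarith
  have hqpos : 0 < (q (π + η)).re := by
    have := hqre (π + η) (by simp [abs_of_pos hη])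
    rw [add_sub_cancel_left, abs_of_pos hη] at this
    linarith [(abs_le.mp this).1]
  have hqneg : (q (π - η)).re < 0 := by
    have := hqre (π - η) (by simp [abs_of_pos hη])
    rw [sub_sub_cancel_left, abs_neg, abs_of_pos hη] at this
    linarith [(abs_le.mp this).2]
  have hqne : ∀ t, |t - π| ≤ η → t ≠ π → (q t).re ≠ 0 := by
    intro t ht hne h0
    have := hqre t ht
    rw [h0, zero_sub, abs_neg] at this
    have h2 : 0 < |t - π| := abs_pos.mpr (sub_ne_zero.mpr hne)
    linarith
  -- points of the curve outside the central arc differ from the central point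
  have hout : ∀ a b : ℝ, 0 ≤ a → b ≤ 2 * π → a ≤ b → (b < π ∨ π < a) → v π ∉ v '' Set.uIcc a b := by
    rintro a b ha hb hab hcase ⟨s, hs, hsv⟩
    rw [Set.uIcc_of_le hab] at hs
    obtain ⟨n, hn⟩ := hinj s π hsv
    have hn1 : (n : ℝ) < 1 := by
      by_contra hcon
      nlinarith [hs.2, hs.1, not_lt.mp hcon]
    have hn2 : (-1 : ℝ) < n := by
      by_contra hcon
      nlinarith [hs.2, hs.1, not_lt.mp hcon]
    have hn0 : n = 0 := by
      have h3 : n < 1 := by exact_mod_cast hn1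
      have h4 : -1 < n := by exact_mod_cast hn2
      omega
    rw [hn0] at hn
    have : s = π := by simpa [sub_eq_zero] using hn
    rcases hcase with h | h <;> linarith [hs.1, hs.2]
  let R : ℂ → ℂ := fun z => (∫ t in (0 : ℝ)..(π - η), deriv v t / (v t - z)) +
    ∫ t in (π + η)..(2 * π), deriv v t / (v t - z)
  have hR : ContinuousAt R (v π) :=
    (hasDerivAt_integral_deriv_div hv (hout 0 (π - η) le_rfl (by linarith) (by linarith)
      (Or.inl (by linarith)))).continuousAt.add
    (hasDerivAt_integral_deriv_div hv (hout (π + η) (2 * π) (by linarith) le_rfl (by linarith)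
      (Or.inr (by linarith)))).continuousAt
  have hkey : ∀ σ : ℝ, |σ| = 1 → c σ = R (v π) +
      (Complex.log (σ * Complex.I * q (π + η)) - Complex.log (σ * Complex.I * q (π - η))) := by
    intro σ hσ
    have hσ2 : (σ : ℂ) * σ = 1 := by
      have : σ * σ = 1 := by rw [← abs_mul_abs_self, hσ, one_mul]
      exact_mod_cast this
    have hσ0 : σ ≠ 0 := by
      rintro rfl
      simp at hσ
    have hσim : ∀ z : ℂ, (σ * Complex.I * z).im = σ * z.re := fun z => by simp
    have hslit : ∀ t, |t - π| ≤ η → ∀ δ : ℝ, 0 < δ →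
        σ * Complex.I * q t + δ ∈ Complex.slitPlane := by
      intro t ht δ hδ
      rw [Complex.mem_slitPlane_iff]
      by_cases htp : t = π
      · left
        simp [htp, q, hδ]
      · right
        rw [Complex.add_im, Complex.ofReal_im, add_zero, hσim]
        exact mul_ne_zero hσ0 (hqne t ht htp)
    have hslit0 : ∀ t, (q t).re ≠ 0 → σ * Complex.I * q t ∈ Complex.slitPlane := fun t ht => by
      rw [Complex.mem_slitPlane_iff, hσim]
      exact Or.inr (mul_ne_zero hσ0 ht)
    have hev : ∀ᶠ δ : ℝ in 𝓝[>] 0, c σ = R (v π + (σ * δ : ℝ) * (Complex.I * τ)) +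
        (Complex.log (σ * Complex.I * q (π + η) + δ) -
          Complex.log (σ * Complex.I * q (π - η) + δ)) := by
      filter_upwards [hc σ hσ, self_mem_nhdsWithin] with δ hδ hδ0
      rw [← hδ.2]
      set z := v π + (σ * δ : ℝ) * (Complex.I * τ) with hz
      have hne : ∀ t, v t - z ≠ 0 := fun t h0 => hδ.1 ⟨t, sub_eq_zero.mp h0⟩
      have hint : ∀ a b : ℝ, IntervalIntegrable (fun t => deriv v t / (v t - z)) volume a b :=
        fun a b => (hv'c.div (by fun_prop) hne).intervalIntegrable a b
      have hmid : ∫ t in (π - η)..(π + η), deriv v t / (v t - z) =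
          Complex.log (σ * Complex.I * q (π + η) + δ) -
            Complex.log (σ * Complex.I * q (π - η) + δ) := by
        refine intervalIntegral.integral_eq_sub_of_hasDerivAt
          (f := fun t => Complex.log (σ * Complex.I * q t + δ)) ?_ (hint _ _)
        intro t ht
        rw [Set.uIcc_of_le (by linarith)] at ht
        have h1 : HasDerivAt (fun t => σ * Complex.I * q t + δ)
            (σ * Complex.I * (deriv v t / τ)) t :=
          (((((hv.differentiable one_ne_zero t).hasDerivAt).sub_const _).div_const
            τ).const_mul _).add_const _
        have h2 := h1.clog_real (hslit t (abs_le.mpr ⟨by linarith [ht.1], by linarith [ht.2]⟩) δ hδ0)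
        have h3 : σ * Complex.I * q t + δ = σ * Complex.I / τ * (v t - z) := by
          simp only [q, hz]
          push_cast
          field_simp
          linear_combination (-(δ : ℂ) * τ) * hσ2 + ((σ : ℂ) ^ 2 * δ * τ) * Complex.I_sq
        have h4 : σ * Complex.I * (deriv v t / τ) / (σ * Complex.I * q t + δ) =
            deriv v t / (v t - z) := by
          rw [h3]
          have h5 : (σ : ℂ) ≠ 0 := by exact_mod_cast hσ0
          have h6 := hne t
          have h7 := Complex.I_ne_zero
          field_simp
        exact h4 ▸ h2
      rw [cauchyInt, ← hmid, ← intervalIntegral.integral_add_adjacent_intervals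
        (hint 0 (π - η)) (hint (π - η) (2 * π)), ← intervalIntegral.integral_add_adjacent_intervals
        (hint (π - η) (π + η)) (hint (π + η) (2 * π))]
      simp only [R]
      ring
    have hl1 : ContinuousAt (fun δ : ℝ => R (v π + (σ * δ : ℝ) * (Complex.I * τ))) 0 := by
      have h1 : Continuous fun δ : ℝ => v π + (σ * δ : ℝ) * (Complex.I * τ) := by fun_prop
      have h2 : ContinuousAt R (v π + (σ * (0 : ℝ) : ℝ) * (Complex.I * τ)) := by simpa using hR
      exact ContinuousAt.comp (f := fun δ : ℝ => v π + (σ * δ : ℝ) * (Complex.I * τ)) h2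
        h1.continuousAt
    have hl2 : ∀ t, (q t).re ≠ 0 →
        ContinuousAt (fun δ : ℝ => Complex.log (σ * Complex.I * q t + δ)) 0 := by
      intro t ht
      refine ContinuousAt.clog (by fun_prop) ?_
      simpa using hslit0 t ht
    have hlim := (hl1.add ((hl2 _ hqpos.ne').sub (hl2 _ hqneg.ne))).tendsto.mono_left
      (nhdsWithin_le_nhds (s := Set.Ioi 0))
    have := tendsto_nhds_unique (tendsto_const_nhds.congr' hev) hlim
    simpa using this
  have h1 := hkey 1 (by simp)
  have h2 := hkey (-1) (by simp)
  have h3 := log_sub_log_neg_of_im_pos (z := Complex.I * q (π + η)) (by simpa using hqpos)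
  have h4 := log_sub_log_neg_of_im_neg (z := Complex.I * q (π - η)) (by simpa using hqneg)
  rw [h1, h2]
  push_cast
  simp only [one_mul, neg_mul]
  linear_combination h3 - h4

/-- The Cauchy integral of a simple closed regular curve takes, off the curve, only the two values
it has near the curve. -/
theorem cauchyInt_eq_side {v : ℝ → ℂ} (hv : ContDiff ℝ 1 v)
    (hp : Function.Periodic v (2 * π)) (hreg : ∀ t, deriv v t ≠ 0) {c : ℝ → ℂ}
    (hc : ∀ σ : ℝ, |σ| = 1 → ∀ t, ∀ᶠ δ : ℝ in 𝓝[>] 0,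
      v t + (σ * δ : ℝ) * (Complex.I * deriv v t) ∉ Set.range v ∧
        cauchyInt v (v t + (σ * δ : ℝ) * (Complex.I * deriv v t)) = c σ)
    {z : ℂ} (hz : z ∉ Set.range v) : cauchyInt v z = c 1 ∨ cauchyInt v z = c (-1) := by
  have hvc : Continuous v := hv.continuous
  obtain ⟨_, ⟨t, rfl⟩, ht⟩ := (isCompact_range_of_periodic hvc hp).exists_infDist_eq_dist
    (Set.range_nonempty v) z
  have hmin : ∀ s, ‖v t - z‖ ≤ ‖v s - z‖ := fun s => by
    rw [← dist_eq_norm, ← dist_eq_norm, dist_comm, dist_comm (v s), ← ht]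
    exact Metric.infDist_le_dist_of_mem ⟨s, rfl⟩
  have hd : HasDerivAt (fun s => ‖v s - z‖ ^ 2) (2 * inner ℝ (v t - z) (deriv v t)) t :=
    (((hv.differentiable one_ne_zero t).hasDerivAt).sub_const z).norm_sq
  have horth : 2 * inner ℝ (v t - z) (deriv v t) = 0 := by
    refine IsLocalMin.hasDerivAt_eq_zero (Eventually.of_forall fun s => ?_) hd
    exact pow_le_pow_left₀ (norm_nonneg _) (hmin s) 2
  obtain ⟨l, hl⟩ : ∃ l : ℝ, z = v t + l * (Complex.I * deriv v t) := by
    refine ⟨((z - v t) / deriv v t).im, ?_⟩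
    have hre : ((z - v t) / deriv v t).re = 0 := by
      rw [Complex.inner] at horth
      rw [Complex.div_re, ← add_div]
      simp at horth
      have : (z - v t).re * (deriv v t).re + (z - v t).im * (deriv v t).im = 0 := by
        simp
        linarith
      rw [this, zero_div]
    have h1 := Complex.re_add_im ((z - v t) / deriv v t)
    rw [hre, Complex.ofReal_zero, zero_add] at h1
    rw [← mul_assoc, h1, div_mul_cancel₀ _ (hreg t)]
    ring
  have hl0 : l ≠ 0 := by
    rintro rfl
    exact hz ⟨t, by simp [hl]⟩
  let γ : ℝ → ℂ := fun s => v t + (s * l : ℝ) * (Complex.I * deriv v t)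
  have hγ : Continuous γ := by fun_prop
  have hpos : 0 < ‖v t - z‖ := norm_pos_iff.mpr fun h0 => hz ⟨t, sub_eq_zero.mp h0⟩
  have hoff : ∀ s ∈ Set.Ioc (0 : ℝ) 1, γ s ∉ Set.range v := by
    rintro s ⟨hs0, hs1⟩ ⟨x, hx⟩
    have h1 := hmin x
    have h2 : v x - z = (1 - s : ℝ) * (v t - z) := by
      rw [hx, hl]
      simp only [γ]
      push_cast
      ring
    rw [h2, norm_mul, Complex.norm_real, Real.norm_of_nonneg (by linarith)] at h1
    nlinarith
  have hconst : ∀ s ∈ Set.Ioc (0 : ℝ) 1, cauchyInt v (γ s) = cauchyInt v z := by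
    intro s hs
    refine cauchyInt_eq_of_isPreconnected hv hp (S := γ '' Set.Ioc 0 1)
      (isPreconnected_Ioc.image _ hγ.continuousOn) ?_ ⟨s, hs, rfl⟩
      ⟨1, ⟨one_pos, le_rfl⟩, by simp [γ, ← hl]⟩
    rintro _ ⟨s, hs, rfl⟩
    exact hoff s hs
  have hside : ∀ σ : ℝ, |σ| = 1 → l = σ * |l| → cauchyInt v z = c σ := by
    intro σ hσ hlσ
    obtain ⟨δ, hδ, hδl⟩ := ((hc σ hσ t).and (Ioo_mem_nhdsGT (abs_pos.mpr hl0))).exists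
    rw [← hδ.2, ← hconst (δ / |l|) ⟨div_pos hδl.1 (abs_pos.mpr hl0),
      (div_le_one (abs_pos.mpr hl0)).mpr hδl.2.le⟩]
    have : δ / |l| * l = σ * δ := by
      have h1 : |l| ≠ 0 := abs_ne_zero.mpr hl0
      nth_rewrite 2 [hlσ]
      field_simp
    simp only [γ, this]
  rcases le_total 0 l with h | h
  · exact Or.inl (hside 1 (by simp) (by rw [abs_of_nonneg h, one_mul]))
  · exact Or.inr (hside (-1) (by simp) (by rw [abs_of_nonpos h]; ring))

/-- The interior of a simple closed regular curve, and Green's formula for it. -/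
theorem exists_interior_green {v : ℝ → ℂ} (hv : ContDiff ℝ 1 v)
    (hp : Function.Periodic v (2 * π))
    (hinj : ∀ t s : ℝ, v t = v s → ∃ n : ℤ, t - s = 2 * π * (n : ℝ))
    (hreg : ∀ t, deriv v t ≠ 0) :
    ∃ Ω : Set ℂ, IsOpen Ω ∧ Ω.Nonempty ∧
      (∀ C : Set ℂ, Convex ℝ C → Set.range v ⊆ C → Ω ⊆ C) ∧
      ∃ ε : ℝ, ε ≠ 0 ∧ ∀ F : ℂ → ℂ, ContDiff ℝ 1 F → HasCompactSupport F →
        ∫ t in (0 : ℝ)..(2 * π), F (v t) * deriv v t = ε * Complex.I * ∫ z in Ω, twoDbar F z := by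
  have hvc : Continuous v := hv.continuous
  have hside : ∀ σ : ℝ, ∃ c : ℂ, |σ| = 1 → ∀ t, ∀ᶠ δ : ℝ in 𝓝[>] 0,
      v t + (σ * δ : ℝ) * (Complex.I * deriv v t) ∉ Set.range v ∧
        cauchyInt v (v t + (σ * δ : ℝ) * (Complex.I * deriv v t)) = c := by
    intro σ
    by_cases hσ : |σ| = 1
    · obtain ⟨c, hc⟩ := exists_cauchyInt_side_eq hv hp hinj hreg hσ
      exact ⟨c, fun _ => hc⟩
    · exact ⟨0, fun h => absurd h hσ⟩
  choose c hc using hside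
  have hjump := cauchyInt_jump hv hinj hreg fun σ hσ => hc σ hσ π
  have htwo : ∀ z, z ∉ Set.range v → cauchyInt v z = c 1 ∨ cauchyInt v z = c (-1) :=
    fun z hz => cauchyInt_eq_side hv hp hreg hc hz
  have hzero : c 1 = 0 ∨ c (-1) = 0 := by
    obtain ⟨M, hM⟩ := (isCompact_range_of_periodic hvc hp).isBounded.exists_norm_le
    have hsub : Set.range v ⊆ Metric.closedBall 0 M := fun z hz => by
      simpa using hM z hz
    have hz : ((|M| + 1 : ℝ) : ℂ) ∉ Metric.closedBall (0 : ℂ) M := by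
      rw [mem_closedBall_zero_iff, Complex.norm_real, Real.norm_of_nonneg (by positivity)]
      linarith [le_abs_self M]
    have h0 := cauchyInt_eq_zero_of_notMem_convex hv hp (convex_closedBall 0 M) hsub hz
    have := htwo _ fun h => hz (hsub h)
    rw [h0] at this
    exact this.imp Eq.symm Eq.symm
  have h2pi : (2 * π * Complex.I : ℂ) ≠ 0 := Complex.two_pi_I_ne_zero
  -- `σ₀` is the side on which the Cauchy integral does not vanish
  obtain ⟨σ₀, hσ₀, hcσ, hvals⟩ : ∃ σ₀ : ℝ, |σ₀| = 1 ∧ c σ₀ = 2 * π * Complex.I * σ₀ ∧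
      ∀ z, z ∉ Set.range v → cauchyInt v z = 0 ∨ cauchyInt v z = c σ₀ := by
    rcases hzero with h | h
    · refine ⟨-1, by simp, ?_, fun z hz => ?_⟩
      · push_cast
        linear_combination h - hjump
      · rw [← h]
        exact htwo z hz
    · refine ⟨1, by simp, ?_, fun z hz => ?_⟩
      · push_cast
        linear_combination h + hjump
      · rw [← h]
        exact (htwo z hz).symm
  have hσ0 : σ₀ ≠ 0 := by
    rintro rfl
    simp at hσ₀
  have hcne : c σ₀ ≠ 0 := by
    rw [hcσ]
    exact mul_ne_zero h2pi (by exact_mod_cast hσ0)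
  let Ω : Set ℂ := {z | z ∉ Set.range v ∧ cauchyInt v z ≠ 0}
  have hΩo : IsOpen Ω := by
    rw [isOpen_iff_mem_nhds]
    rintro z ⟨hz, hz0⟩
    filter_upwards [eventually_cauchyInt_eq hv hp hz] with w hw
    exact ⟨hw.1, by rw [hw.2]; exact hz0⟩
  refine ⟨Ω, hΩo, ?_, ?_, σ₀, hσ0, ?_⟩
  · obtain ⟨δ, hδ⟩ := (hc σ₀ hσ₀ 0).exists
    exact ⟨_, hδ.1, by rw [hδ.2]; exact hcne⟩
  · intro C hC hvC z hz
    by_contra hzC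
    exact hz.2 (cauchyInt_eq_zero_of_notMem_convex hv hp hC hvC hzC)
  · intro F hF hFc
    have h1 := curveIntegral_eq_integral_twoDbar hv hF hFc
    have h2 : ∫ z, twoDbar F z * cauchyInt v z = c σ₀ * ∫ z in Ω, twoDbar F z := by
      rw [← integral_indicator hΩo.measurableSet, ← integral_const_mul]
      refine integral_congr_ae ?_
      have hnull : ∀ᵐ z : ℂ, z ∉ Set.range v := measure_eq_zero_iff_ae_notMem.mp
        (volume_range_eq_zero hv)
      filter_upwards [hnull] with z hz
      by_cases hzΩ : z ∈ Ω
      · rw [Set.indicator_of_mem hzΩ, (hvals z hz).resolve_left hzΩ.2, mul_comm]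
      · have h0 : cauchyInt v z = 0 := by
          by_contra h0
          exact hzΩ ⟨hz, h0⟩
        rw [Set.indicator_of_notMem hzΩ, h0, mul_zero, mul_zero]
    rw [h2, hcσ] at h1
    have h3 : (2 * π : ℂ) ≠ 0 := by exact_mod_cast Real.two_pi_pos.ne'
    refine mul_left_cancel₀ h3 (h1.trans ?_)
    ring

theorem IsKLoop.hasDerivAt {K : ℝ × ℝ → ℝ} {u : ℝ → ℝ × ℝ} (hu : IsKLoop K u) (t : ℝ) :
    HasDerivAt (fun t => (u t).1) (deriv u t).1 t ∧ HasDerivAt (fun t => (u t).2) (deriv u t).2 t := by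
  have h := (hu.1.differentiable two_ne_zero t).hasDerivAt
  exact ⟨(ContinuousLinearMap.fst ℝ ℝ ℝ).hasFDerivAt.comp_hasDerivAt t h,
    (ContinuousLinearMap.snd ℝ ℝ ℝ).hasFDerivAt.comp_hasDerivAt t h⟩

theorem IsKLoop.hasDerivAt_deriv {K : ℝ × ℝ → ℝ} {u : ℝ → ℝ × ℝ} (hu : IsKLoop K u) (t : ℝ) :
    HasDerivAt (fun t => (deriv u t).1)
      (2 * (deriv u t).1 * (deriv u t).2 / (u t).2 - hypL u * K (u t) * (deriv u t).2) t ∧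
    HasDerivAt (fun t => (deriv u t).2)
      (((deriv u t).2 ^ 2 - (deriv u t).1 ^ 2) / (u t).2 + hypL u * K (u t) * (deriv u t).1) t := by
  have h1 : Differentiable ℝ (deriv u) := by
    have : ContDiff ℝ (1 + 1) u := by
      rw [one_add_one_eq_two]
      exact hu.1
    exact (contDiff_succ_iff_deriv.mp this).2.2.differentiable one_ne_zero
  have h := (h1 t).hasDerivAt
  have ho := hu.2.2.2.2 t
  rw [sub_eq_iff_eq_add] at ho
  rw [ho] at h
  refine ⟨?_, ?_⟩
  · refine ((ContinuousLinearMap.fst ℝ ℝ ℝ).hasFDerivAt.comp_hasDerivAt t h).congr_deriv ?_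
    simp [Gam, rot]
    ring
  · refine ((ContinuousLinearMap.snd ℝ ℝ ℝ).hasFDerivAt.comp_hasDerivAt t h).congr_deriv ?_
    simp [Gam, rot]
    ring

/-- A `K`-loop is regular and its length functional is nonzero. -/
theorem IsKLoop.regular {K : ℝ × ℝ → ℝ} {u : ℝ → ℝ × ℝ} (hu : IsKLoop K u) :
    (∀ t, deriv u t ≠ 0) ∧ hypL u ≠ 0 := by
  let E : ℝ → ℝ := fun t => ((deriv u t).1 ^ 2 + (deriv u t).2 ^ 2) / (u t).2 ^ 2
  have hE : ∀ t, HasDerivAt E 0 t := by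
    intro t
    have hy := (hu.2.2.1 t).ne'
    obtain ⟨h1, h2⟩ := hu.hasDerivAt_deriv t
    have h3 := (hu.hasDerivAt t).2
    have h4 := ((h1.pow 2).add (h2.pow 2)).div (h3.pow 2) (pow_ne_zero 2 hy)
    refine h4.congr_deriv ?_
    simp only [Pi.add_apply, Pi.pow_apply]
    field_simp
    ring
  have hconst : ∀ t, E t = E 0 := fun t => is_const_of_deriv_eq_zero
    (fun t => (hE t).differentiableAt) (fun t => (hE t).deriv) t 0
  have hE0 : ∀ t, deriv u t = 0 → E 0 = 0 := fun t ht => by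
    rw [← hconst t]
    simp [E, ht]
  have hE0ne : E 0 ≠ 0 := by
    intro h0
    refine hu.2.2.2.1 ⟨u 0, fun t => is_const_of_deriv_eq_zero
      (hu.1.differentiable two_ne_zero) (fun s => ?_) t 0⟩
    have h1 := hconst s
    rw [h0, div_eq_zero_iff] at h1
    have h2 := h1.resolve_right (pow_ne_zero 2 (hu.2.2.1 s).ne')
    ext
    · show (deriv u s).1 = 0
      nlinarith [sq_nonneg (deriv u s).1, sq_nonneg (deriv u s).2]
    · show (deriv u s).2 = 0
      nlinarith [sq_nonneg (deriv u s).1, sq_nonneg (deriv u s).2]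
  refine ⟨fun t ht => hE0ne (hE0 t ht), ?_⟩
  have hL : hypL u = Real.sqrt (E 0) := by
    have h1 : (∫ t in (0 : ℝ)..(2 * π),
        ((deriv u t).1 ^ 2 + (deriv u t).2 ^ 2) / (u t).2 ^ 2) = 2 * π * E 0 := by
      rw [intervalIntegral.integral_congr (g := fun _ => E 0) fun t _ => hconst t]
      simp
    rw [hypL, h1]
    congr 1
    field_simp
  rw [hL]
  have : 0 ≤ E 0 := by positivity
  exact ne_of_gt (Real.sqrt_pos.mpr (lt_of_le_of_ne this hE0ne.symm))

/-- The real Killing fields `α + βz + γz²` of the upper half-plane. -/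
def killing (α β γ : ℝ) (z : ℝ × ℝ) : ℝ × ℝ :=
  (α + β * z.1 + γ * (z.1 ^ 2 - z.2 ^ 2), β * z.2 + 2 * γ * z.1 * z.2)

theorem IsKLoop.integral_killing_normal {K : ℝ × ℝ → ℝ} {u : ℝ → ℝ × ℝ} (hu : IsKLoop K u)
    (hK : ContinuousOn K {z : ℝ × ℝ | 0 < z.2}) (α β γ : ℝ) :
    ∫ t in (0 : ℝ)..(2 * π), K (u t) * ((killing α β γ (u t)).1 * (deriv u t).2 -
      (killing α β γ (u t)).2 * (deriv u t).1) / (u t).2 ^ 2 = 0 := by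
  let N : ℝ → ℝ := fun t => ((deriv u t).1 * (α + β * (u t).1 + γ * ((u t).1 ^ 2 - (u t).2 ^ 2)) +
    (deriv u t).2 * (β * (u t).2 + 2 * γ * (u t).1 * (u t).2)) / (u t).2 ^ 2
  have hN : ∀ t ∈ Set.uIcc 0 (2 * π), HasDerivAt N (-hypL u * (K (u t) *
      ((killing α β γ (u t)).1 * (deriv u t).2 -
        (killing α β γ (u t)).2 * (deriv u t).1) / (u t).2 ^ 2)) t := by
    intro t _
    have hy := (hu.2.2.1 t).ne'
    obtain ⟨h1, h2⟩ := hu.hasDerivAt_deriv t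
    obtain ⟨h3, h4⟩ := hu.hasDerivAt t
    have hX1 := ((h3.const_mul β).const_add α).add (((h3.pow 2).sub (h4.pow 2)).const_mul γ)
    have hX2 := (h4.const_mul β).add ((h3.const_mul (2 * γ)).mul h4)
    have h5 := ((h1.mul hX1).add (h2.mul hX2)).div (h4.pow 2) (pow_ne_zero 2 hy)
    refine h5.congr_deriv ?_
    simp only [Pi.add_apply, Pi.pow_apply, Pi.mul_apply, Pi.sub_apply, killing]
    field_simp
    ring
  have huc := hu.1.continuous
  have hu'c : Continuous (deriv u) := hu.1.continuous_deriv one_le_two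
  have hKu : Continuous fun t => K (u t) := hK.comp_continuous huc fun t => hu.2.2.1 t
  have hint := intervalIntegral.integral_eq_sub_of_hasDerivAt hN (by
    refine Continuous.intervalIntegrable ?_ _ _
    refine continuous_const.mul (Continuous.div ?_ (by fun_prop)
      fun t => pow_ne_zero 2 (hu.2.2.1 t).ne')
    simp only [killing]
    exact hKu.mul (by fun_prop))
  have hper : N (2 * π) = N 0 := by
    have h1 : u (2 * π) = u 0 := by simpa using hu.2.1 0
    have h2 : deriv u (2 * π) = deriv u 0 := by
      have := deriv_comp_add_const u (2 * π) 0
      rw [zero_add] at this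
      rw [← this]
      congr 1
      exact funext hu.2.1
    simp only [N, h1, h2]
  rw [hper, sub_self, intervalIntegral.integral_const_mul] at hint
  exact (mul_eq_zero.mp hint).resolve_left (neg_ne_zero.mpr hu.regular.2)

/-- The complex field whose `∂̄`-derivative has real part the hyperbolic divergence of `K` times
the Killing field. -/
def killingFlux (K : ℝ × ℝ → ℝ) (α β γ : ℝ) (z : ℂ) : ℂ :=
  ((K (z.re, z.im) * (killing α β γ (z.re, z.im)).1 / z.im ^ 2 : ℝ) : ℂ) -
    ((K (z.re, z.im) * (killing α β γ (z.re, z.im)).2 / z.im ^ 2 : ℝ) : ℂ) * Complex.I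

theorem killingFlux_re (K : ℝ × ℝ → ℝ) (α β γ : ℝ) (z : ℂ) : (killingFlux K α β γ z).re =
    K (z.re, z.im) * (killing α β γ (z.re, z.im)).1 / z.im ^ 2 := by
  rw [killingFlux, Complex.sub_re, Complex.ofReal_re, Complex.re_ofReal_mul]
  simp

theorem killingFlux_im (K : ℝ × ℝ → ℝ) (α β γ : ℝ) (z : ℂ) : (killingFlux K α β γ z).im =
    -(K (z.re, z.im) * (killing α β γ (z.re, z.im)).2 / z.im ^ 2) := by
  rw [killingFlux, Complex.sub_im, Complex.ofReal_im, Complex.im_ofReal_mul]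
  simp

theorem contDiffAt_killingFlux {K : ℝ × ℝ → ℝ} (hK : ContDiffOn ℝ 1 K {z : ℝ × ℝ | 0 < z.2})
    (α β γ : ℝ) {z : ℂ} (hz : 0 < z.im) : ContDiffAt ℝ 1 (killingFlux K α β γ) z := by
  have hK1 : ContDiffAt ℝ 1 K (z.re, z.im) :=
    hK.contDiffAt ((isOpen_lt continuous_const continuous_snd).mem_nhds hz)
  have hre : ContDiffAt ℝ 1 Complex.re z := Complex.reCLM.contDiff.contDiffAt
  have him : ContDiffAt ℝ 1 Complex.im z := Complex.imCLM.contDiff.contDiffAt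
  have hk : ContDiffAt ℝ 1 (fun z : ℂ => K (z.re, z.im)) z :=
    hK1.comp z (f := fun z : ℂ => (z.re, z.im)) (hre.prodMk him)
  have hP : ContDiffAt ℝ 1
      (fun z : ℂ => K (z.re, z.im) * (killing α β γ (z.re, z.im)).1 / z.im ^ 2) z := by
    simp only [killing]
    exact (hk.mul ((contDiffAt_const.add (contDiffAt_const.mul hre)).add
      (contDiffAt_const.mul ((hre.pow 2).sub (him.pow 2))))).div (him.pow 2) (pow_ne_zero 2 hz.ne')
  have hQ : ContDiffAt ℝ 1
      (fun z : ℂ => K (z.re, z.im) * (killing α β γ (z.re, z.im)).2 / z.im ^ 2) z := by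
    simp only [killing]
    exact (hk.mul ((contDiffAt_const.mul him).add
      ((contDiffAt_const.mul hre).mul him))).div (him.pow 2) (pow_ne_zero 2 hz.ne')
  exact (Complex.ofRealCLM.contDiff.contDiffAt.comp z hP).sub
    ((Complex.ofRealCLM.contDiff.contDiffAt.comp z hQ).mul contDiffAt_const)

theorem re_twoDbar_killingFlux {K : ℝ × ℝ → ℝ} (hK : ContDiffOn ℝ 1 K {z : ℝ × ℝ | 0 < z.2})
    (α β γ : ℝ) {z : ℂ} (hz : 0 < z.im) : (twoDbar (killingFlux K α β γ) z).re =
      fderiv ℝ K (z.re, z.im) (killing α β γ (z.re, z.im)) / z.im ^ 2 := by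
  have hG := ((contDiffAt_killingFlux hK α β γ hz).differentiableAt one_ne_zero).hasFDerivAt
  have hK1 : HasFDerivAt K (fderiv ℝ K (z.re, z.im)) (z.re, z.im) :=
    ((hK.contDiffAt ((isOpen_lt continuous_const continuous_snd).mem_nhds hz)).differentiableAt
      one_ne_zero).hasFDerivAt
  have hy : z.im ≠ 0 := hz.ne'
  have e1 : HasDerivAt (fun s : ℝ => (killingFlux K α β γ (z + s)).re)
      ((fderiv ℝ (killingFlux K α β γ) z 1).re) 0 := by
    have hl : HasDerivAt (fun s : ℝ => z + s) 1 0 :=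
      (Complex.ofRealCLM.hasDerivAt (x := (0 : ℝ))).const_add z
    exact Complex.reCLM.hasFDerivAt.comp_hasDerivAt (0 : ℝ)
      (HasFDerivAt.comp_hasDerivAt (0 : ℝ) (by simpa using hG) hl)
  have e2 : HasDerivAt (fun s : ℝ => (killingFlux K α β γ (z + s * Complex.I)).im)
      ((fderiv ℝ (killingFlux K α β γ) z Complex.I).im) 0 := by
    have hl : HasDerivAt (fun s : ℝ => z + s * Complex.I) Complex.I 0 := by
      simpa using ((Complex.ofRealCLM.hasDerivAt (x := (0 : ℝ))).mul_const Complex.I).const_add z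
    exact Complex.imCLM.hasFDerivAt.comp_hasDerivAt (0 : ℝ)
      (HasFDerivAt.comp_hasDerivAt (0 : ℝ) (by simpa using hG) hl)
  have hx : HasDerivAt (fun s : ℝ => z.re + s) 1 0 := (hasDerivAt_id (0 : ℝ)).const_add _
  have hyy : HasDerivAt (fun s : ℝ => z.im + s) 1 0 := (hasDerivAt_id (0 : ℝ)).const_add _
  have k1 : HasDerivAt (fun s : ℝ => K (z.re + s, z.im)) (fderiv ℝ K (z.re, z.im) (1, 0)) 0 :=
    HasFDerivAt.comp_hasDerivAt (f := fun s : ℝ => (z.re + s, z.im)) (0 : ℝ) (by simpa using hK1)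
      (hx.prodMk (hasDerivAt_const _ _))
  have k2 : HasDerivAt (fun s : ℝ => K (z.re, z.im + s)) (fderiv ℝ K (z.re, z.im) (0, 1)) 0 :=
    HasFDerivAt.comp_hasDerivAt (f := fun s : ℝ => (z.re, z.im + s)) (0 : ℝ) (by simpa using hK1)
      ((hasDerivAt_const _ _).prodMk hyy)
  have d1 := (k1.mul (((hx.const_mul β).const_add α).add
    (((hx.pow 2).sub_const (z.im ^ 2)).const_mul γ))).div_const (z.im ^ 2)
  have d2 := ((k2.mul ((hyy.const_mul β).add (hyy.const_mul (2 * γ * z.re)))).div (hyy.pow 2)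
    (by simpa using hy)).neg
  have f1 := e1.unique (d1.congr_of_eventuallyEq (.of_forall fun s => by
    simp [killingFlux_re, killing]))
  have f2 := e2.unique (d2.congr_of_eventuallyEq (.of_forall fun s => by
    simp [killingFlux_im, killing]))
  have hsplit : fderiv ℝ K (z.re, z.im) (killing α β γ (z.re, z.im)) =
      (killing α β γ (z.re, z.im)).1 * fderiv ℝ K (z.re, z.im) (1, 0) +
      (killing α β γ (z.re, z.im)).2 * fderiv ℝ K (z.re, z.im) (0, 1) := by
    rw [← smul_eq_mul, ← smul_eq_mul, ← map_smul, ← map_smul, ← map_add]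
    simp
  rw [hsplit, twoDbar, Complex.add_re, Complex.I_mul_re, f1, f2]
  simp only [killing, Pi.add_apply, Pi.pow_apply, Pi.mul_apply, add_zero]
  field_simp
  ring

theorem exists_contDiff_hasCompactSupport_eventuallyEq {G : ℂ → ℂ} {C U : Set ℂ}
    (hC : IsCompact C) (hU : IsOpen U) (hCU : C ⊆ U) (hG : ∀ z ∈ U, ContDiffAt ℝ 1 G z) :
    ∃ F : ℂ → ℂ, ContDiff ℝ 1 F ∧ HasCompactSupport F ∧ ∀ z ∈ C, F =ᶠ[𝓝 z] G := by
  obtain ⟨L, hL, hCL, hLU⟩ := exists_compact_between hC hU hCU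
  obtain ⟨χ, h1, h0, -⟩ := exists_contMDiffMap_one_nhds_of_subset_interior
    (n := 1) (modelWithCornersSelf ℝ ℂ) hC.isClosed hCL
  have hχ : ContDiff ℝ 1 χ := χ.contMDiff.contDiff
  refine ⟨fun z => χ z • G z, contDiff_iff_contDiffAt.mpr fun z => ?_,
    HasCompactSupport.intro hL fun z hz => by simp [h0 z hz], fun z hz => ?_⟩
  · by_cases hz : z ∈ L
    · exact hχ.contDiffAt.smul (hG z (hLU hz))
    · refine (contDiffAt_const (c := (0 : ℂ))).congr_of_eventuallyEq ?_
      filter_upwards [hL.isClosed.isOpen_compl.mem_nhds hz] with w hw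
      simp [h0 w hw]
  · filter_upwards [h1.filter_mono (nhds_le_nhdsSet hz)] with w hw
    simp [hw]

theorem twoDbar_congr {F G : ℂ → ℂ} {z : ℂ} (h : F =ᶠ[𝓝 z] G) : twoDbar F z = twoDbar G z := by
  rw [twoDbar, twoDbar, h.fderiv_eq]

theorem exists_sign_of_forall_ne_zero {K : ℝ × ℝ → ℝ}
    (hK : ContDiffOn ℝ 1 K {z : ℝ × ℝ | 0 < z.2}) {α β γ : ℝ}
    (h : ∀ z : ℝ × ℝ, 0 < z.2 → fderiv ℝ K z (killing α β γ z) ≠ 0) :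
    ∃ s : ℝ, ∀ z : ℝ × ℝ, 0 < z.2 → 0 < s * fderiv ℝ K z (killing α β γ z) := by
  have hU : IsOpen {z : ℝ × ℝ | 0 < z.2} := isOpen_lt continuous_const continuous_snd
  have hconv : Convex ℝ {z : ℝ × ℝ | 0 < z.2} :=
    convex_halfSpace_gt (LinearMap.snd ℝ ℝ ℝ).isLinear 0
  have hX : Continuous (killing α β γ) := by
    unfold killing
    fun_prop
  have hc : ContinuousOn (fun z => fderiv ℝ K z (killing α β γ z)) {z : ℝ × ℝ | 0 < z.2} :=
    (hK.continuousOn_fderiv_of_isOpen hU le_rfl).clm_apply hX.continuousOn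
  have hord := (hconv.isPreconnected.image _ hc).ordConnected
  have key : ∀ z w : ℝ × ℝ, 0 < z.2 → 0 < w.2 → fderiv ℝ K z (killing α β γ z) < 0 →
      ¬ 0 < fderiv ℝ K w (killing α β γ w) := by
    intro z w hz hw h1 h2
    obtain ⟨p, hp, hp0⟩ := hord.out (Set.mem_image_of_mem _ hz) (Set.mem_image_of_mem _ hw)
      (⟨h1.le, h2.le⟩ : (0 : ℝ) ∈ Set.Icc _ _)
    exact h p hp hp0
  by_cases hs : ∃ z : ℝ × ℝ, 0 < z.2 ∧ fderiv ℝ K z (killing α β γ z) < 0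
  · obtain ⟨z, hz, hz1⟩ := hs
    refine ⟨-1, fun w hw => ?_⟩
    have := lt_of_le_of_ne (not_lt.mp (key z w hz hw hz1)) (h w hw)
    linarith
  · push Not at hs
    refine ⟨1, fun w hw => ?_⟩
    rw [one_mul]
    exact lt_of_le_of_ne (hs w hw) (h w hw).symm

theorem not_embedded_of_killing {K : ℝ × ℝ → ℝ} (hK : ContDiffOn ℝ 1 K {z : ℝ × ℝ | 0 < z.2})
    {α β γ : ℝ} (h : ∀ z : ℝ × ℝ, 0 < z.2 → fderiv ℝ K z (killing α β γ z) ≠ 0)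
    {u : ℝ → ℝ × ℝ} (hu : IsKLoop K u) : ¬ IsEmbedded u := by
  intro he
  obtain ⟨s, hs⟩ := exists_sign_of_forall_ne_zero hK h
  let v : ℝ → ℂ := fun t => Complex.equivRealProdCLM.symm (u t)
  have hv : ContDiff ℝ 1 v :=
    Complex.equivRealProdCLM.symm.contDiff.comp (hu.1.of_le one_le_two)
  have hd : ∀ t, deriv v t = Complex.equivRealProdCLM.symm (deriv u t) := fun t =>
    (Complex.equivRealProdCLM.symm.hasFDerivAt.comp_hasDerivAt t
      (hu.1.differentiable two_ne_zero t).hasDerivAt).deriv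
  have hp : Function.Periodic v (2 * π) := fun t => congrArg Complex.equivRealProdCLM.symm (hu.2.1 t)
  have hinj : ∀ t s : ℝ, v t = v s → ∃ n : ℤ, t - s = 2 * π * (n : ℝ) := fun t s hts =>
    he t s (Complex.equivRealProdCLM.symm.injective hts)
  have hreg : ∀ t, deriv v t ≠ 0 := fun t ht => hu.regular.1 t
    (Complex.equivRealProdCLM.symm.injective (by rw [← hd, ht, map_zero]))
  obtain ⟨Ω, hΩ, hne, hsub, ε, hε, hgreen⟩ := exists_interior_green hv hp hinj hreg
  have hcomp : IsCompact (Set.range v) := hp.compact_of_continuous (by positivity) hv.continuous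
  obtain ⟨_, ⟨t₀, rfl⟩, hmin⟩ := hcomp.exists_isMinOn (Set.range_nonempty v)
    Complex.continuous_im.continuousOn
  let C : Set ℂ := closure (convexHull ℝ (Set.range v))
  have hCc : IsCompact C := (isBounded_convexHull.mpr hcomp.isBounded).isCompact_closure
  have hvC : Set.range v ⊆ C := (subset_convexHull ℝ _).trans subset_closure
  have hCU : C ⊆ {z : ℂ | 0 < z.im} := by
    have h1 : C ⊆ {z : ℂ | (v t₀).im ≤ z.im} := closure_minimal
      (convexHull_min (fun z hz => hmin hz) (convex_halfSpace_im_ge _))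
      (isClosed_le continuous_const Complex.continuous_im)
    exact fun z hz => (hu.2.2.1 t₀).trans_le (h1 hz)
  have hΩC : Ω ⊆ C := hsub C (convex_convexHull ℝ _).closure hvC
  obtain ⟨F, hF, hFc, hFG⟩ := exists_contDiff_hasCompactSupport_eventuallyEq hCc
    (isOpen_lt continuous_const Complex.continuous_im) hCU
    (fun z hz => contDiffAt_killingFlux hK α β γ hz)
  have hvd : Continuous (deriv v) := hv.continuous_deriv le_rfl
  have hleft : (∫ t in (0 : ℝ)..(2 * π), F (v t) * deriv v t).im = 0 := by
    have hi : IntervalIntegrable (fun t => F (v t) * deriv v t) volume 0 (2 * π) :=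
      ((hF.continuous.comp hv.continuous).mul hvd).intervalIntegrable _ _
    rw [← Complex.imCLM_apply, ← Complex.imCLM.intervalIntegral_comp_comm hi]
    refine (intervalIntegral.integral_congr fun t _ => ?_).trans
      (hu.integral_killing_normal hK.continuousOn α β γ)
    have h1 : F (v t) = killingFlux K α β γ (v t) :=
      (hFG _ (hvC ⟨t, rfl⟩)).eq_of_nhds
    have hre : (v t).re = (u t).1 := rfl
    have him : (v t).im = (u t).2 := rfl
    have hre' : (deriv v t).re = (deriv u t).1 := by rw [hd]; rfl
    have him' : (deriv v t).im = (deriv u t).2 := by rw [hd]; rfl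
    simp only [Complex.imCLM_apply, h1, Complex.mul_im, killingFlux_re, killingFlux_im, hre, him,
      hre', him']
    ring
  have hFi : Integrable (twoDbar F) :=
    (continuous_twoDbar hF).integrable_of_hasCompactSupport (hasCompactSupport_twoDbar hFc)
  have hzero : ∫ z in Ω, (twoDbar F z).re = 0 := by
    rw [hgreen F hF hFc] at hleft
    have h2 : ∫ z in Ω, (twoDbar F z).re = (∫ z in Ω, twoDbar F z).re :=
      Complex.reCLM.integral_comp_comm hFi.integrableOn
    rw [h2]
    rw [mul_assoc, Complex.im_ofReal_mul, Complex.I_mul_im] at hleft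
    exact (mul_eq_zero.mp hleft).resolve_left hε
  have hpos : ∀ z ∈ Ω, 0 < s * (twoDbar F z).re := by
    intro z hz
    have him : 0 < z.im := hCU (hΩC hz)
    rw [twoDbar_congr (hFG z (hΩC hz)), re_twoDbar_killingFlux hK α β γ him, ← mul_div_assoc]
    exact div_pos (hs _ him) (by positivity)
  have hlt : 0 < ∫ z in Ω, s * (twoDbar F z).re := by
    rw [setIntegral_pos_iff_support_of_nonneg_ae
      (ae_restrict_of_forall_mem hΩ.measurableSet fun z hz => (hpos z hz).le)
      (hFi.re.const_mul s).integrableOn]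
    refine (hΩ.measure_pos volume hne).trans_le (measure_mono fun z hz => ⟨(hpos z hz).ne', hz⟩)
  rw [integral_const_mul, hzero, mul_zero] at hlt
  exact lt_irrefl _ hlt

/-- if `∂₁K`, or `∇K(z)·z`, or `∇K(z)·z²` never vanishes on `H²`,
then no embedded `K`-loop exists. -/
theorem stmt_2 (K : (ℝ × ℝ) → ℝ)
    (hK : ContDiffOn ℝ 1 K {z : ℝ × ℝ | 0 < z.2})
    (h : (∀ z : ℝ × ℝ, 0 < z.2 → fderiv ℝ K z ((1:ℝ), (0:ℝ)) ≠ 0) ∨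
         (∀ z : ℝ × ℝ, 0 < z.2 → fderiv ℝ K z z ≠ 0) ∨
         (∀ z : ℝ × ℝ, 0 < z.2 → fderiv ℝ K z (z.1 ^ 2 - z.2 ^ 2, 2 * z.1 * z.2) ≠ 0)) :
    ¬ ∃ u : ℝ → ℝ × ℝ, IsKLoop K u ∧ IsEmbedded u := by
  rintro ⟨u, hu, he⟩
  rcases h with h | h | h
  · exact not_embedded_of_killing (α := 1) (β := 0) (γ := 0) hK
      (fun z hz => by simpa [killing] using h z hz) hu he
  · exact not_embedded_of_killing (α := 0) (β := 1) (γ := 0) hK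
      (fun z hz => by simpa [killing] using h z hz) hu he
  · exact not_embedded_of_killing (α := 0) (β := 0) (γ := 1) hK
      (fun z hz => by simpa [killing] using h z hz) hu he
end
end

section
/- Let k>1 and let u : ℝ → H² be a nonconstant C² 2π-periodic solution of u'' − u₂⁻¹Γ(u') = L(u) k iu'. Let m_u = min_{t∈ℝ} u₂(t) and let t_u ∈ ℝ be a point where u₂(t_u) = m_u. Then u'(t_u) = (m_u L(u), 0). -/
open Real MeasureTheory Filter Topology

noncomputable section

theorem hasDerivAt_fst_comp {v : ℝ → ℝ × ℝ} {t : ℝ} (h : DifferentiableAt ℝ v t) :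
    HasDerivAt (fun s => (v s).1) (deriv v t).1 t :=
  (ContinuousLinearMap.fst ℝ ℝ ℝ).hasFDerivAt.comp_hasDerivAt t h.hasDerivAt

theorem hasDerivAt_snd_comp {v : ℝ → ℝ × ℝ} {t : ℝ} (h : DifferentiableAt ℝ v t) :
    HasDerivAt (fun s => (v s).2) (deriv v t).2 t :=
  (ContinuousLinearMap.snd ℝ ℝ ℝ).hasFDerivAt.comp_hasDerivAt t h.hasDerivAt

/-- Second-order necessary condition at a local minimum. -/
theorem deriv_deriv_nonneg_of_isLocalMin {f : ℝ → ℝ} {a : ℝ} (h : IsLocalMin f a)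
    (hf : ContinuousAt f a) : 0 ≤ deriv (deriv f) a := by
  by_contra! hneg
  have hmax : IsLocalMax f a := isLocalMax_of_deriv_deriv_neg hneg h.deriv_eq_zero hf
  have hconst : f =ᶠ[𝓝 a] fun _ => f a := by
    filter_upwards [h, hmax] with t h₁ h₂ using le_antisymm h₂ h₁
  have hzero := hconst.deriv.deriv_eq
  simp at hzero
  exact hneg.ne hzero

/-- The squared hyperbolic speed of a `K`-loop is constantly `L(u)²`, and `L(u)` is positive. -/
theorem IsKLoop.speed_eq {K : ℝ × ℝ → ℝ} {u : ℝ → ℝ × ℝ} (hu : IsKLoop K u) :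
    0 < hypL u ∧
      ∀ t, (deriv u t).1 ^ 2 + (deriv u t).2 ^ 2 = (hypL u * (u t).2) ^ 2 := by
  obtain ⟨hC, -, hpos, hnc, heq⟩ := hu
  have hd : Differentiable ℝ u := hC.differentiable (by norm_num)
  have hdd : Differentiable ℝ (deriv u) :=
    (contDiff_succ_iff_deriv (n := 1).1 hC).2.2.differentiable (by norm_num)
  set E : ℝ → ℝ := fun t => ((deriv u t).1 ^ 2 + (deriv u t).2 ^ 2) / (u t).2 ^ 2
  have hE' : ∀ t, HasDerivAt E 0 t := by
    intro t
    have hy := hasDerivAt_snd_comp (hd t)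
    have hx' := hasDerivAt_fst_comp (hdd t)
    have hy' := hasDerivAt_snd_comp (hdd t)
    have hne := (hpos t).ne'
    have h₁ := congrArg Prod.fst (heq t)
    have h₂ := congrArg Prod.snd (heq t)
    simp only [Prod.fst_sub, Prod.snd_sub, Prod.smul_fst, Prod.smul_snd, Gam, rot,
      smul_eq_mul] at h₁ h₂
    rw [sub_eq_iff_eq_add] at h₁ h₂
    refine (((hx'.fun_pow 2).fun_add (hy'.fun_pow 2)).fun_div (hy.fun_pow 2)
      (pow_ne_zero 2 hne)).congr_deriv ?_
    rw [h₁, h₂]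
    field_simp
    ring
  have hEc : ∀ t, E t = E 0 := fun t =>
    is_const_of_deriv_eq_zero (fun s => (hE' s).differentiableAt) (fun s => (hE' s).deriv) t 0
  have hE0 : 0 ≤ E 0 := by positivity
  have hL : hypL u = √(E 0) := by
    have hint : ∫ t in (0:ℝ)..(2 * π), E t = 2 * π * E 0 := by
      simp [hEc]
    rw [hypL, hint]
    congr 1
    field_simp
  have hsp : ∀ t, (deriv u t).1 ^ 2 + (deriv u t).2 ^ 2 = (hypL u * (u t).2) ^ 2 := by
    intro t
    rw [mul_pow, hL, Real.sq_sqrt hE0, ← hEc t]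
    exact (div_mul_cancel₀ _ (pow_ne_zero 2 (hpos t).ne')).symm
  refine ⟨(Real.sqrt_nonneg _).lt_of_ne fun h0 => hnc ⟨u 0, fun t => ?_⟩, hsp⟩
  refine is_const_of_deriv_eq_zero hd (fun s => ?_) t 0
  have hs := hsp s
  rw [show hypL u = 0 from h0.symm] at hs
  ext
  · simp only [Prod.fst_zero]; nlinarith [sq_nonneg (deriv u s).1, sq_nonneg (deriv u s).2]
  · simp only [Prod.snd_zero]; nlinarith [sq_nonneg (deriv u s).1, sq_nonneg (deriv u s).2]

/-- at a point `t_u` where the second coordinate of a nonconstant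
`2π`-periodic solution of the constant-curvature-`k` equation attains its minimum `m_u`,
the derivative is `u'(t_u) = (m_u L(u), 0)`. -/
theorem stmt_5 (k : ℝ) (hk : 1 < k) (u : ℝ → ℝ × ℝ)
    (hu : IsKLoop (fun _ => k) u)
    (tu : ℝ) (hmin : ∀ t : ℝ, (u tu).2 ≤ (u t).2) :
    deriv u tu = ((u tu).2 * hypL u, 0) := by
  obtain ⟨hL, hsp⟩ := hu.speed_eq
  obtain ⟨hC, -, hpos, -, heq⟩ := hu
  have hd : Differentiable ℝ u := hC.differentiable (by norm_num)
  have hdd : Differentiable ℝ (deriv u) :=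
    (contDiff_succ_iff_deriv (n := 1).1 hC).2.2.differentiable (by norm_num)
  have hy : deriv (fun t => (u t).2) = fun t => (deriv u t).2 :=
    funext fun t => (hasDerivAt_snd_comp (hd t)).deriv
  have hloc : IsLocalMin (fun t => (u t).2) tu := Eventually.of_forall hmin
  have hy0 : (deriv u tu).2 = 0 := by
    simpa only [hy] using hloc.deriv_eq_zero
  have hy2 : 0 ≤ (deriv (deriv u) tu).2 := by
    have h := deriv_deriv_nonneg_of_isLocalMin hloc (hasDerivAt_snd_comp (hd tu)).continuousAt
    rwa [hy, (hasDerivAt_snd_comp (hdd tu)).deriv] at h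
  have h₂ := congrArg Prod.snd (heq tu)
  simp only [Prod.snd_sub, Prod.smul_snd, Gam, rot, smul_eq_mul, hy0] at h₂
  have hx2 := hsp tu
  rw [hy0] at hx2
  have hm := hpos tu
  have hx : 0 ≤ (deriv u tu).1 := by
    have hterm : 0 ≤ (u tu).2⁻¹ * (deriv u tu).1 ^ 2 := by positivity
    have hprod : 0 ≤ (hypL u * k) * (deriv u tu).1 := by linarith
    exact nonneg_of_mul_nonneg_right hprod (by positivity)
  ext
  · have hsq : (deriv u tu).1 ^ 2 = ((u tu).2 * hypL u) ^ 2 := by linarith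
    exact (pow_left_inj₀ hx (by positivity) two_ne_zero).1 hsq
  · exact hy0
end
end

section
/- Let k>1. A C² 2π-periodic function g : ℝ → ℝ² satisfies Bg = 0 if and only if g is a real linear combination of the three functions e₁ ≡ (1,0), γ(t) = (k cos t, −R_k⁻¹ sin t), and γ'(t) = (−k sin t, −R_k⁻¹ cos t). -/
open Real MeasureTheory Filter Topology

noncomputable section

/-- `R_k = (k² - 1)^{-1/2}`. -/
def Rk (k : ℝ) : ℝ := 1 / Real.sqrt (k ^ 2 - 1)

/-- The reference loop `ω(t) = (cos t, 1/R_k) / (k - sin t)`, a parameterization of the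
hyperbolic circle of center `(0,1)` and hyperbolic radius `ρ_k = artanh(1/k)`. -/
def om (k : ℝ) (t : ℝ) : ℝ × ℝ := (cos t / (k - sin t), (1 / Rk k) / (k - sin t))

/-- The differential `Γ'(w)v = 2(v₂ w - v₁ iw)`. -/
def Gam' (w v : ℝ × ℝ) : ℝ × ℝ := (2 * v.2) • w - (2 * v.1) • rot w

/-- The operator `𝓙`, equal to `ω₂²` times the linearization at `ω` of the
constant-curvature-`k` loop equation:
`𝓙(φ) = -φ'' + kR_k iφ' + ω₂⁻¹Γ'(ω')φ' - ω₂⁻²φ₂Γ(ω') - k²(⨍ ω₂⁻²φ·iω') iω'`. -/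
def Jop (k : ℝ) (φ : ℝ → ℝ × ℝ) (t : ℝ) : ℝ × ℝ :=
  -(deriv (deriv φ) t) + (k * Rk k) • rot (deriv φ t)
    + ((om k t).2)⁻¹ • Gam' (deriv (om k) t) (deriv φ t)
    - ((φ t).2 / (om k t).2 ^ 2) • Gam (deriv (om k) t)
    - (k ^ 2 * ((1 / (2 * π)) * ∫ s in (0:ℝ)..(2 * π),
        dotp (φ s) (rot (deriv (om k) s)) / (om k s).2 ^ 2)) • rot (deriv (om k) t)

/-- The operator `B g = -g'' - kR_k ig' + R_k²(g₂ - k² ⨍ g₂) e₂`. -/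
def Bop (k : ℝ) (g : ℝ → ℝ × ℝ) (t : ℝ) : ℝ × ℝ :=
  -(deriv (deriv g) t) - (k * Rk k) • rot (deriv g t)
    + (Rk k ^ 2 * ((g t).2 - k ^ 2 * ((1 / (2 * π)) * ∫ s in (0:ℝ)..(2 * π), (g s).2)))
        • ((0:ℝ), (1:ℝ))

/-- Solutions of `y'' = -y` are linear combinations of `cos` and `sin`. -/
theorem eq_cos_add_sin_of_hasDerivAt {y y' : ℝ → ℝ} (hy : ∀ t, HasDerivAt y (y' t) t)
    (hy' : ∀ t, HasDerivAt y' (-y t) t) (t : ℝ) : y t = y 0 * cos t + y' 0 * sin t := by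
  have hp : ∀ s, HasDerivAt (fun s => y s * cos s - y' s * sin s) 0 s := fun s =>
    (((hy s).mul (hasDerivAt_cos s)).sub ((hy' s).mul (hasDerivAt_sin s))).congr_deriv (by ring)
  have hq : ∀ s, HasDerivAt (fun s => y s * sin s + y' s * cos s) 0 s := fun s =>
    (((hy s).mul (hasDerivAt_sin s)).add ((hy' s).mul (hasDerivAt_cos s))).congr_deriv (by ring)
  have ep := is_const_of_deriv_eq_zero (fun s => (hp s).differentiableAt)
    (fun s => (hp s).deriv) t 0
  have eq := is_const_of_deriv_eq_zero (fun s => (hq s).differentiableAt)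
    (fun s => (hq s).deriv) t 0
  simp only [cos_zero, sin_zero, mul_one, mul_zero, sub_zero, zero_add] at ep eq
  linear_combination cos t * ep + sin t * eq - y t * sin_sq_add_cos_sq t

theorem Rk_pos {k : ℝ} (hk : 1 < k) : 0 < Rk k :=
  one_div_pos.mpr (Real.sqrt_pos.mpr (by nlinarith))

theorem Rk_sq_mul {k : ℝ} (hk : 1 < k) : Rk k ^ 2 * (k ^ 2 - 1) = 1 := by
  have h : 0 < k ^ 2 - 1 := by nlinarith
  rw [Rk, div_pow, Real.sq_sqrt h.le]
  field_simp

/-- The derivative of a `T`-periodic function has integral zero over `[0, T]`. -/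
theorem integral_eq_zero_of_hasDerivAt_of_periodic {f v : ℝ → ℝ} {T : ℝ}
    (hf : ∀ t, HasDerivAt f (v t) t) (hv : Continuous v) (hper : Function.Periodic f T) :
    ∫ t in (0:ℝ)..T, v t = 0 := by
  rw [intervalIntegral.integral_eq_sub_of_hasDerivAt (fun t _ => hf t)
    (hv.intervalIntegrable _ _), hper.eq, sub_self]

/-- Periodic solutions `(x, y)` of the system `-x'' + kR y' = 0`,
`-y'' - kR x' + R²(y - k² ⨍ y) = 0` with `R²(k² - 1) = 1`. -/
theorem exists_trig_of_periodic_system {k R : ℝ} (hR : R ^ 2 * (k ^ 2 - 1) = 1)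
    {x x' x'' y y' y'' : ℝ → ℝ}
    (hx : ∀ t, HasDerivAt x (x' t) t) (hx' : ∀ t, HasDerivAt x' (x'' t) t)
    (hy : ∀ t, HasDerivAt y (y' t) t) (hy' : ∀ t, HasDerivAt y' (y'' t) t)
    (px : Function.Periodic x (2 * π)) (py' : Function.Periodic y' (2 * π))
    (h₁ : ∀ t, -x'' t + k * R * y' t = 0)
    (h₂ : ∀ t, -y'' t - k * R * x' t
      + R ^ 2 * (y t - k ^ 2 * ((1 / (2 * π)) * ∫ s in (0:ℝ)..(2 * π), y s)) = 0) :
    ∃ a, ∀ t, x t = a + k * R * (y 0 * sin t - y' 0 * cos t) ∧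
      y t = y 0 * cos t + y' 0 * sin t := by
  have cx' : Continuous x' := continuous_iff_continuousAt.mpr fun t => (hx' t).continuousAt
  have cy : Continuous y := continuous_iff_continuousAt.mpr fun t => (hy t).continuousAt
  have hπ := Real.pi_pos
  set I := ∫ s in (0:ℝ)..(2 * π), y s with hI
  have ix' := integral_eq_zero_of_hasDerivAt_of_periodic hx cx' px
  have e₂ : ∀ t, y'' t
      = -(k * R) * x' t + (R ^ 2 * y t - R ^ 2 * k ^ 2 * ((1 / (2 * π)) * I)) :=
    fun t => by linear_combination -h₂ t
  have iy'' := integral_eq_zero_of_hasDerivAt_of_periodic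
    (fun t => (hy' t).congr_deriv (e₂ t)) (by fun_prop) py'
  have I0 : I = 0 := by
    rw [intervalIntegral.integral_add (Continuous.intervalIntegrable (by fun_prop) _ _)
      (Continuous.intervalIntegrable (by fun_prop) _ _),
      intervalIntegral.integral_sub (Continuous.intervalIntegrable (by fun_prop) _ _)
      (Continuous.intervalIntegrable (by fun_prop) _ _),
      intervalIntegral.integral_const_mul, intervalIntegral.integral_const_mul, ix', ← hI,
      intervalIntegral.integral_const, smul_eq_mul] at iy''
    field_simp at iy''
    have h : (2 * π) * I = 0 := by linear_combination -(2 * π * I) * hR - iy''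
    exact (mul_eq_zero.mp h).resolve_left (by positivity)
  have hC : ∀ s, HasDerivAt (fun s => x' s - k * R * y s) 0 s := fun s =>
    ((hx' s).sub ((hy s).const_mul (k * R))).congr_deriv (by linear_combination -h₁ s)
  obtain ⟨C, eC⟩ : ∃ C, ∀ t, x' t = k * R * y t + C :=
    ⟨x' 0 - k * R * y 0, fun t => by
      linear_combination is_const_of_deriv_eq_zero (fun s => (hC s).differentiableAt)
        (fun s => (hC s).deriv) t 0⟩
  have C0 : C = 0 := by
    rw [funext eC,
      intervalIntegral.integral_add (Continuous.intervalIntegrable (by fun_prop) _ _)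
      (Continuous.intervalIntegrable (by fun_prop) _ _),
      intervalIntegral.integral_const_mul, ← hI, I0,
      intervalIntegral.integral_const, smul_eq_mul] at ix'
    have h2 : (2 * π) * C = 0 := by linear_combination ix'
    exact (mul_eq_zero.mp h2).resolve_left (by positivity)
  have ey : ∀ t, y t = y 0 * cos t + y' 0 * sin t :=
    eq_cos_add_sin_of_hasDerivAt hy fun t => (hy' t).congr_deriv (by
      rw [e₂, eC, C0, I0]
      linear_combination -y t * hR)
  have ha : ∀ s, HasDerivAt (fun s => x s - k * R * (y 0 * sin s - y' 0 * cos s)) 0 s :=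
    fun s => ((hx s).sub ((((hasDerivAt_sin s).const_mul (y 0)).sub
      ((hasDerivAt_cos s).const_mul (y' 0))).const_mul (k * R))).congr_deriv (by
        rw [eC, C0]
        linear_combination k * R * ey s)
  refine ⟨x 0 + k * R * y' 0, fun t => ⟨?_, ey t⟩⟩
  have := is_const_of_deriv_eq_zero (fun s => (ha s).differentiableAt)
    (fun s => (ha s).deriv) t 0
  simp only [sin_zero, cos_zero] at this
  linear_combination this

theorem hasDerivAt_trig (p q r t : ℝ) :
    HasDerivAt (fun t => p + q * cos t + r * sin t) (0 + r * cos t + -q * sin t) t :=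
  ((((hasDerivAt_cos t).const_mul q).const_add p).add
    ((hasDerivAt_sin t).const_mul r)).congr_deriv (by ring)

/-- the kernel of `B` on C² `2π`-periodic functions is spanned by
`e₁`, `γ(t) = (k cos t, -R_k⁻¹ sin t)` and `γ'(t) = (-k sin t, -R_k⁻¹ cos t)`. -/
theorem stmt_8 (k : ℝ) (hk : 1 < k) (g : ℝ → ℝ × ℝ)
    (hg : ContDiff ℝ 2 g) (hper : Function.Periodic g (2 * π)) :
    (∀ t : ℝ, Bop k g t = 0) ↔
    ∃ a b c : ℝ, ∀ t : ℝ,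
      g t = a • (((1:ℝ), (0:ℝ)) : ℝ × ℝ) + b • ((k * cos t, -(sin t) / Rk k) : ℝ × ℝ)
          + c • ((-(k * sin t), -(cos t) / Rk k) : ℝ × ℝ) := by
  have hR := Rk_sq_mul hk
  have hR0 := (Rk_pos hk).ne'
  constructor
  · intro h
    have d₁ : ∀ t, HasDerivAt g (deriv g t) t := fun t =>
      (hg.differentiable (by norm_num) t).hasDerivAt
    have d₂ : ∀ t, HasDerivAt (deriv g) (deriv (deriv g) t) t := fun t =>
      ((hg.differentiable_deriv_two) t).hasDerivAt
    have d₁_per : Function.Periodic (deriv g) (2 * π) := fun t => by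
      rw [← deriv_comp_add_const, hper.funext]
    obtain ⟨a, ha⟩ := exists_trig_of_periodic_system hR
      (fun t => (d₁ t).fst) (fun t => (d₂ t).fst) (fun t => (d₁ t).snd) (fun t => (d₂ t).snd)
      (fun t => congrArg Prod.fst (hper t)) (fun t => congrArg Prod.snd (d₁_per t))
      (fun t => by simpa [Bop, rot] using congrArg Prod.fst (h t))
      (fun t => by simpa [Bop, rot] using congrArg Prod.snd (h t))
    refine ⟨a, -Rk k * (deriv g 0).2, -Rk k * (g 0).2, fun t => Prod.ext ?_ ?_⟩
    · simp only [Prod.fst_add, Prod.smul_fst, smul_eq_mul]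
      rw [(ha t).1]
      ring
    · simp only [Prod.snd_add, Prod.smul_snd, smul_eq_mul]
      rw [(ha t).2]
      field_simp
      ring
  · rintro ⟨a, b, c, h⟩ t
    have hg' : g = fun t => (a + b * k * cos t + -(c * k) * sin t,
        0 + -(c / Rk k) * cos t + -(b / Rk k) * sin t) := by
      funext t
      rw [h]
      ext <;> simp <;> ring
    have d₁ := fun p q r p' q' r' : ℝ => funext fun t =>
      ((hasDerivAt_trig p q r t).prodMk (hasDerivAt_trig p' q' r' t)).deriv
    have hI : ∫ s in (0:ℝ)..(2 * π), (g s).2 = 0 := by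
      refine integral_eq_zero_of_hasDerivAt_of_periodic
        (f := fun t => 0 + b / Rk k * cos t + -(c / Rk k) * sin t) (fun t => ?_)
        hg.continuous.snd (fun t => by simp)
      rw [hg']
      exact (hasDerivAt_trig _ _ _ t).congr_deriv (by ring)
    rw [Bop, hI, hg', d₁, d₁]
    ext
    · simp [rot]
      field_simp
      ring
    · simp [rot]
      field_simp
      linear_combination (c * cos t + b * sin t) * hR
end
end
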